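/- The bigraded Poincaré series of the mixed trace algebra of two generic 3×3 matrices satisfies P(T_{3,2}; s,t) = 1 / ((1−s)²(1−t)²·(1−s²)(1−st)²(1−t²)·(1−s²t)(1−st²)). -/

import Mathlib

open MvPolynomial Matrix

noncomputable section

/-- Index type for the entries of a pair of generic `n × n` matrices:
`Sum.inl (i,j)` indexes the `(i,j)` entry of `x`, `Sum.inr (i,j)` that of `y`. -/
abbrev MatVar (n : ℕ) := (Fin n × Fin n) ⊕ (Fin n × Fin n)

/-- The substitution sending the variables to the entries of the pair `(A, B)`. -/
def pairSub {K : Type*} [CommSemiring K] {n : ℕ} (A B : Matrix (Fin n) (Fin n) K) :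
    MatVar n → K
  | Sum.inl ij => A ij.1 ij.2
  | Sum.inr ij => B ij.1 ij.2

/-- A polynomial function on pairs of `n × n` matrices is `GLₙ`-invariant (for the action
by simultaneous conjugation). -/
def IsMatInvariant {K : Type*} [Field K] {n : ℕ} (f : MvPolynomial (MatVar n) K) : Prop :=
  ∀ (a : GL (Fin n) K) (A B : Matrix (Fin n) (Fin n) K),
    MvPolynomial.eval
        (pairSub ((a : Matrix (Fin n) (Fin n) K) * A * ((a⁻¹ : GL (Fin n) K) : Matrix (Fin n) (Fin n) K))
          ((a : Matrix (Fin n) (Fin n) K) * B * ((a⁻¹ : GL (Fin n) K) : Matrix (Fin n) (Fin n) K))) f =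
      MvPolynomial.eval (pairSub A B) f

/-- The weight giving the bidegree: entries of `x` have weight `(1,0)`,
those of `y` have weight `(0,1)`. -/
def bideg (n : ℕ) : MatVar n → ℕ × ℕ
  | Sum.inl _ => (1, 0)
  | Sum.inr _ => (0, 1)

/-- The bigraded component of bidegree `(p, q)` of the pure trace algebra `C_{n,2}`. -/
def pureComponent (K : Type*) [Field K] (n p q : ℕ) : Set (MvPolynomial (MatVar n) K) :=
  {f | IsMatInvariant f ∧ f.IsWeightedHomogeneous (bideg n) (p, q)}

/-- `dim_K C_{n,2}^{(p,q)}`. -/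
def pureDim (K : Type*) [Field K] (n p q : ℕ) : ℕ :=
  Set.finrank K (pureComponent K n p q)

/-- The bigraded Poincaré series `P(C_{n,2}; s, t)`, with `s` the variable `X 0` and
`t` the variable `X 1`. -/
def purePS2 (K : Type*) [Field K] (n : ℕ) : MvPowerSeries (Fin 2) ℚ :=
  fun d => (pureDim K n (d 0) (d 1) : ℚ)

/-- abbreviation for the power series variable `s`. -/
def ps : MvPowerSeries (Fin 2) ℚ := MvPowerSeries.X 0

/-- abbreviation for the power series variable `t`. -/
def pt : MvPowerSeries (Fin 2) ℚ := MvPowerSeries.X 1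


/-- A polynomial map `M_n² → M_n`, given by a matrix of polynomials in the entries of the
pair `(x, y)`, is `GLₙ`-equivariant. -/
def IsMatEquivariant {K : Type*} [Field K] {n : ℕ}
    (M : Matrix (Fin n) (Fin n) (MvPolynomial (MatVar n) K)) : Prop :=
  ∀ (a : GL (Fin n) K) (A B : Matrix (Fin n) (Fin n) K),
    M.map (MvPolynomial.eval
        (pairSub ((a : Matrix (Fin n) (Fin n) K) * A * ((a⁻¹ : GL (Fin n) K) : Matrix (Fin n) (Fin n) K))
          ((a : Matrix (Fin n) (Fin n) K) * B * ((a⁻¹ : GL (Fin n) K) : Matrix (Fin n) (Fin n) K)))) =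
      (a : Matrix (Fin n) (Fin n) K) * M.map (MvPolynomial.eval (pairSub A B)) *
        ((a⁻¹ : GL (Fin n) K) : Matrix (Fin n) (Fin n) K)

/-- The bigraded component of bidegree `(p, q)` of the mixed trace algebra `T_{n,2}`. -/
def mixedComponent (K : Type*) [Field K] (n p q : ℕ) :
    Set (Matrix (Fin n) (Fin n) (MvPolynomial (MatVar n) K)) :=
  {M | IsMatEquivariant M ∧ ∀ i j, (M i j).IsWeightedHomogeneous (bideg n) (p, q)}

/-- `dim_K T_{n,2}^{(p,q)}`. -/
def mixedDim (K : Type*) [Field K] (n p q : ℕ) : ℕ :=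
  Set.finrank K (mixedComponent K n p q)

/-- The bigraded Poincaré series `P(T_{n,2}; s, t)`, with `s` the variable `X 0` and
`t` the variable `X 1`. -/
def mixedPS2 (K : Type*) [Field K] (n : ℕ) : MvPowerSeries (Fin 2) ℚ :=
  fun d => (mixedDim K n (d 0) (d 1) : ℚ)

set_option linter.unusedSimpArgs false
set_option linter.unusedVariables false

/-- A representation of `gl₃` with trivial centre, as a tuple of operators. -/
structure GlRep (K V : Type*) [Field K] [AddCommGroup V] [Module K V] where
  (e1 e2 e3 f1 f2 f3 H1 H2 : Module.End K V)
  e1f1 : ∀ v, e1 (f1 v) = f1 (e1 v) + (2 : K) • H1 v - H2 v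
  e2f2 : ∀ v, e2 (f2 v) = f2 (e2 v) + (2 : K) • H2 v - H1 v
  e3f3 : ∀ v, e3 (f3 v) = f3 (e3 v) + H1 v + H2 v
  e1f2 : ∀ v, e1 (f2 v) = f2 (e1 v)
  e2f1 : ∀ v, e2 (f1 v) = f1 (e2 v)
  e1f3 : ∀ v, e1 (f3 v) = f3 (e1 v) - f2 v
  e2f3 : ∀ v, e2 (f3 v) = f3 (e2 v) + f1 v
  e3f1 : ∀ v, e3 (f1 v) = f1 (e3 v) - e2 v
  e3f2 : ∀ v, e3 (f2 v) = f2 (e3 v) + e1 v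
  e1e2 : ∀ v, e1 (e2 v) = e2 (e1 v) + e3 v
  e1e3 : ∀ v, e1 (e3 v) = e3 (e1 v)
  e2e3 : ∀ v, e2 (e3 v) = e3 (e2 v)
  f2f1 : ∀ v, f2 (f1 v) = f1 (f2 v) + f3 v
  f1f3 : ∀ v, f1 (f3 v) = f3 (f1 v)
  f2f3 : ∀ v, f2 (f3 v) = f3 (f2 v)
  H1e1 : ∀ v, H1 (e1 v) = e1 (H1 v) + e1 v
  H1e2 : ∀ v, H1 (e2 v) = e2 (H1 v)
  H1e3 : ∀ v, H1 (e3 v) = e3 (H1 v) + e3 v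
  H2e1 : ∀ v, H2 (e1 v) = e1 (H2 v)
  H2e2 : ∀ v, H2 (e2 v) = e2 (H2 v) + e2 v
  H2e3 : ∀ v, H2 (e3 v) = e3 (H2 v) + e3 v
  H1f1 : ∀ v, H1 (f1 v) = f1 (H1 v) - f1 v
  H1f2 : ∀ v, H1 (f2 v) = f2 (H1 v)
  H1f3 : ∀ v, H1 (f3 v) = f3 (H1 v) - f3 v
  H2f1 : ∀ v, H2 (f1 v) = f1 (H2 v)
  H2f2 : ∀ v, H2 (f2 v) = f2 (H2 v) - f2 v
  H2f3 : ∀ v, H2 (f3 v) = f3 (H2 v) - f3 v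
  H1H2 : ∀ v, H1 (H2 v) = H2 (H1 v)

namespace GlRep
variable {K V : Type*} [Field K] [AddCommGroup V] [Module K V] (R : GlRep K V)

/-- Half the Casimir operator. -/
def c : Module.End K V :=
  R.H1 * R.H1 - R.H2 * R.H1 + R.H2 * R.H2 + R.H1 + R.H2 + R.f1 * R.e1 + R.f2 * R.e2 + R.f3 * R.e3

lemma c_apply (v : V) : R.c v = R.H1 (R.H1 v) - R.H2 (R.H1 v) + R.H2 (R.H2 v) + R.H1 v + R.H2 v
    + R.f1 (R.e1 v) + R.f2 (R.e2 v) + R.f3 (R.e3 v) := rfl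

/-- Weight spaces. -/
def wt (m n : ℤ) : Submodule K V where
  carrier := {v | R.H1 v = (m : K) • v ∧ R.H2 v = (n : K) • v}
  add_mem' := by
    rintro x y ⟨h1, h2⟩ ⟨h3, h4⟩
    simp [h1, h2, h3, h4]
  zero_mem' := by simp
  smul_mem' := by
    rintro a x ⟨h1, h2⟩
    simp [h1, h2, smul_comm a]

lemma mem_wt {m n : ℤ} {v : V} : v ∈ R.wt m n ↔ R.H1 v = (m : K) • v ∧ R.H2 v = (n : K) • v :=
  Iff.rfl

/-- The invariants. -/
def inv : Submodule K V where
  carrier := {v | R.e1 v = 0 ∧ R.e2 v = 0 ∧ R.e3 v = 0 ∧ R.f1 v = 0 ∧ R.f2 v = 0 ∧ R.f3 v = 0}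
  add_mem' := by
    rintro x y ⟨h1, h2, h3, h4, h5, h6⟩ ⟨g1, g2, g3, g4, g5, g6⟩
    simp [*]
  zero_mem' := by simp
  smul_mem' := by
    rintro a x ⟨h1, h2, h3, h4, h5, h6⟩
    simp [*]


lemma c_e1 (v : V) : R.c (R.e1 v) = R.e1 (R.c v) := by
  simp only [c_apply, map_add, map_sub, map_smul, R.e1f1, R.e1f2, R.e1f3, R.e2f1, R.e2f2, R.e2f3, R.e3f1, R.e3f2, R.e3f3, R.e1e2,
    R.e1e3, R.e2e3, R.f2f1, R.f1f3, R.f2f3, R.H1e1, R.H1e2, R.H1e3, R.H2e1, R.H2e2, R.H2e3,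
    R.H1f1, R.H1f2, R.H1f3, R.H2f1, R.H2f2, R.H2f3, R.H1H2]
  module

lemma c_e2 (v : V) : R.c (R.e2 v) = R.e2 (R.c v) := by
  simp only [c_apply, map_add, map_sub, map_smul, R.e1f1, R.e1f2, R.e1f3, R.e2f1, R.e2f2, R.e2f3, R.e3f1, R.e3f2, R.e3f3, R.e1e2,
    R.e1e3, R.e2e3, R.f2f1, R.f1f3, R.f2f3, R.H1e1, R.H1e2, R.H1e3, R.H2e1, R.H2e2, R.H2e3,
    R.H1f1, R.H1f2, R.H1f3, R.H2f1, R.H2f2, R.H2f3, R.H1H2]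
  module

lemma c_e3 (v : V) : R.c (R.e3 v) = R.e3 (R.c v) := by
  simp only [c_apply, map_add, map_sub, map_smul, R.e1f1, R.e1f2, R.e1f3, R.e2f1, R.e2f2, R.e2f3, R.e3f1, R.e3f2, R.e3f3, R.e1e2,
    R.e1e3, R.e2e3, R.f2f1, R.f1f3, R.f2f3, R.H1e1, R.H1e2, R.H1e3, R.H2e1, R.H2e2, R.H2e3,
    R.H1f1, R.H1f2, R.H1f3, R.H2f1, R.H2f2, R.H2f3, R.H1H2]
  module

lemma c_f1 (v : V) : R.c (R.f1 v) = R.f1 (R.c v) := by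
  simp only [c_apply, map_add, map_sub, map_smul, R.e1f1, R.e1f2, R.e1f3, R.e2f1, R.e2f2, R.e2f3, R.e3f1, R.e3f2, R.e3f3, R.e1e2,
    R.e1e3, R.e2e3, R.f2f1, R.f1f3, R.f2f3, R.H1e1, R.H1e2, R.H1e3, R.H2e1, R.H2e2, R.H2e3,
    R.H1f1, R.H1f2, R.H1f3, R.H2f1, R.H2f2, R.H2f3, R.H1H2]
  module

lemma c_f2 (v : V) : R.c (R.f2 v) = R.f2 (R.c v) := by
  simp only [c_apply, map_add, map_sub, map_smul, R.e1f1, R.e1f2, R.e1f3, R.e2f1, R.e2f2, R.e2f3, R.e3f1, R.e3f2, R.e3f3, R.e1e2,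
    R.e1e3, R.e2e3, R.f2f1, R.f1f3, R.f2f3, R.H1e1, R.H1e2, R.H1e3, R.H2e1, R.H2e2, R.H2e3,
    R.H1f1, R.H1f2, R.H1f3, R.H2f1, R.H2f2, R.H2f3, R.H1H2]
  module

lemma c_f3 (v : V) : R.c (R.f3 v) = R.f3 (R.c v) := by
  simp only [c_apply, map_add, map_sub, map_smul, R.e1f1, R.e1f2, R.e1f3, R.e2f1, R.e2f2, R.e2f3, R.e3f1, R.e3f2, R.e3f3, R.e1e2,
    R.e1e3, R.e2e3, R.f2f1, R.f1f3, R.f2f3, R.H1e1, R.H1e2, R.H1e3, R.H2e1, R.H2e2, R.H2e3,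
    R.H1f1, R.H1f2, R.H1f3, R.H2f1, R.H2f2, R.H2f3, R.H1H2]
  module

lemma c_H1 (v : V) : R.c (R.H1 v) = R.H1 (R.c v) := by
  simp only [c_apply, map_add, map_sub, map_smul, R.e1f1, R.e1f2, R.e1f3, R.e2f1, R.e2f2, R.e2f3, R.e3f1, R.e3f2, R.e3f3, R.e1e2,
    R.e1e3, R.e2e3, R.f2f1, R.f1f3, R.f2f3, R.H1e1, R.H1e2, R.H1e3, R.H2e1, R.H2e2, R.H2e3,
    R.H1f1, R.H1f2, R.H1f3, R.H2f1, R.H2f2, R.H2f3, R.H1H2]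
  module

lemma c_H2 (v : V) : R.c (R.H2 v) = R.H2 (R.c v) := by
  simp only [c_apply, map_add, map_sub, map_smul, R.e1f1, R.e1f2, R.e1f3, R.e2f1, R.e2f2, R.e2f3, R.e3f1, R.e3f2, R.e3f3, R.e1e2,
    R.e1e3, R.e2e3, R.f2f1, R.f1f3, R.f2f3, R.H1e1, R.H1e2, R.H1e3, R.H2e1, R.H2e2, R.H2e3,
    R.H1f1, R.H1f2, R.H1f3, R.H2f1, R.H2f2, R.H2f3, R.H1H2]
  module

lemma wt_e1 {m n m' n' : ℤ} {v : V} (h : v ∈ R.wt m n) (hm : m' = m + (1)) (hn : n' = n + (0)) :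
    R.e1 v ∈ R.wt m' n' := by
  obtain ⟨h1, h2⟩ := h
  subst hm hn
  constructor
  · rw [R.H1e1, h1, map_smul]; push_cast; module
  · rw [R.H2e1, h2, map_smul]; push_cast; module

lemma wt_e2 {m n m' n' : ℤ} {v : V} (h : v ∈ R.wt m n) (hm : m' = m + (0)) (hn : n' = n + (1)) :
    R.e2 v ∈ R.wt m' n' := by
  obtain ⟨h1, h2⟩ := h
  subst hm hn
  constructor
  · rw [R.H1e2, h1, map_smul]; push_cast; module
  · rw [R.H2e2, h2, map_smul]; push_cast; module

lemma wt_e3 {m n m' n' : ℤ} {v : V} (h : v ∈ R.wt m n) (hm : m' = m + (1)) (hn : n' = n + (1)) :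
    R.e3 v ∈ R.wt m' n' := by
  obtain ⟨h1, h2⟩ := h
  subst hm hn
  constructor
  · rw [R.H1e3, h1, map_smul]; push_cast; module
  · rw [R.H2e3, h2, map_smul]; push_cast; module

lemma wt_f1 {m n m' n' : ℤ} {v : V} (h : v ∈ R.wt m n) (hm : m' = m + (-1)) (hn : n' = n + (0)) :
    R.f1 v ∈ R.wt m' n' := by
  obtain ⟨h1, h2⟩ := h
  subst hm hn
  constructor
  · rw [R.H1f1, h1, map_smul]; push_cast; module
  · rw [R.H2f1, h2, map_smul]; push_cast; module

lemma wt_f2 {m n m' n' : ℤ} {v : V} (h : v ∈ R.wt m n) (hm : m' = m + (0)) (hn : n' = n + (-1)) :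
    R.f2 v ∈ R.wt m' n' := by
  obtain ⟨h1, h2⟩ := h
  subst hm hn
  constructor
  · rw [R.H1f2, h1, map_smul]; push_cast; module
  · rw [R.H2f2, h2, map_smul]; push_cast; module

lemma wt_f3 {m n m' n' : ℤ} {v : V} (h : v ∈ R.wt m n) (hm : m' = m + (-1)) (hn : n' = n + (-1)) :
    R.f3 v ∈ R.wt m' n' := by
  obtain ⟨h1, h2⟩ := h
  subst hm hn
  constructor
  · rw [R.H1f3, h1, map_smul]; push_cast; module
  · rw [R.H2f3, h2, map_smul]; push_cast; module

lemma wt_c {m n : ℤ} {v : V} (h : v ∈ R.wt m n) : R.c v ∈ R.wt m n := by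
  obtain ⟨h1, h2⟩ := h
  constructor
  · rw [← R.c_H1, h1, map_smul]
  · rw [← R.c_H2, h2, map_smul]

/-- Submodules invariant under everything. -/
structure Stable (U : Submodule K V) : Prop where
  e1 : ∀ v ∈ U, R.e1 v ∈ U
  e2 : ∀ v ∈ U, R.e2 v ∈ U
  e3 : ∀ v ∈ U, R.e3 v ∈ U
  f1 : ∀ v ∈ U, R.f1 v ∈ U
  f2 : ∀ v ∈ U, R.f2 v ∈ U
  f3 : ∀ v ∈ U, R.f3 v ∈ U
  H1 : ∀ v ∈ U, R.H1 v ∈ U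
  H2 : ∀ v ∈ U, R.H2 v ∈ U

lemma Stable.c {U : Submodule K V} (h : R.Stable U) : ∀ v ∈ U, R.c v ∈ U := by
  intro v hv
  rw [c_apply]
  have := h.H1 _ (h.H1 _ hv)
  have := h.H2 _ (h.H1 _ hv)
  have := h.H2 _ (h.H2 _ hv)
  have := h.H1 _ hv
  have := h.H2 _ hv
  have := h.f1 _ (h.e1 _ hv)
  have := h.f2 _ (h.e2 _ hv)
  have := h.f3 _ (h.e3 _ hv)
  refine U.add_mem (U.add_mem (U.add_mem (U.add_mem (U.add_mem (U.add_mem (U.sub_mem ?_ ?_) ?_) ?_) ?_) ?_) ?_) ?_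
    <;> assumption

lemma lap0 {v : V} (h : v ∈ R.wt 0 0) :
    R.f1 (R.e1 v) + R.f2 (R.e2 v) + R.f3 (R.e3 v) = R.c v := by
  obtain ⟨h1, h2⟩ := h
  simp only [c_apply, h1, h2, map_smul]
  push_cast
  module

lemma lap3 {v : V} (h : v ∈ R.wt 2 2) :
    R.e1 (R.f1 v) - R.e2 (- R.f2 v) + R.e3 (R.f3 v) = R.c v := by
  obtain ⟨h1, h2⟩ := h
  simp only [c_apply, h1, h2, map_smul, map_neg, R.e1f1, R.e2f2, R.e3f3]
  push_cast
  module

lemma lap1_1 {u1 u2 u3 : V} (g1 : u1 ∈ R.wt 1 0) (g2 : u2 ∈ R.wt 0 1)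
    (g3 : u3 ∈ R.wt 1 1) :
    R.e1 (R.f1 u1 + R.f2 u2 + R.f3 u3) + (-R.f2 (R.e1 u2 - R.e2 u1 - u3) - R.f3 (R.e1 u3 - R.e3 u1)) = R.c u1 := by
  obtain ⟨a1, a2⟩ := g1
  obtain ⟨b1, b2⟩ := g2
  obtain ⟨c1, c2⟩ := g3
  simp only [c_apply, map_add, map_sub, map_smul, map_neg, a1, a2, b1, b2, c1, c2, R.e1f1, R.e1f2, R.e1f3, R.e2f1, R.e2f2, R.e2f3, R.e3f1, R.e3f2, R.e3f3, R.e1e2,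
    R.e1e3, R.e2e3, R.f2f1, R.f1f3, R.f2f3, R.H1e1, R.H1e2, R.H1e3, R.H2e1, R.H2e2, R.H2e3,
    R.H1f1, R.H1f2, R.H1f3, R.H2f1, R.H2f2, R.H2f3, R.H1H2]
  push_cast
  module

lemma lap1_2 {u1 u2 u3 : V} (g1 : u1 ∈ R.wt 1 0) (g2 : u2 ∈ R.wt 0 1)
    (g3 : u3 ∈ R.wt 1 1) :
    R.e2 (R.f1 u1 + R.f2 u2 + R.f3 u3) + (R.f1 (R.e1 u2 - R.e2 u1 - u3) - R.f3 (R.e2 u3 - R.e3 u2)) = R.c u2 := by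
  obtain ⟨a1, a2⟩ := g1
  obtain ⟨b1, b2⟩ := g2
  obtain ⟨c1, c2⟩ := g3
  simp only [c_apply, map_add, map_sub, map_smul, map_neg, a1, a2, b1, b2, c1, c2, R.e1f1, R.e1f2, R.e1f3, R.e2f1, R.e2f2, R.e2f3, R.e3f1, R.e3f2, R.e3f3, R.e1e2,
    R.e1e3, R.e2e3, R.f2f1, R.f1f3, R.f2f3, R.H1e1, R.H1e2, R.H1e3, R.H2e1, R.H2e2, R.H2e3,
    R.H1f1, R.H1f2, R.H1f3, R.H2f1, R.H2f2, R.H2f3, R.H1H2]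
  push_cast
  module

lemma lap1_3 {u1 u2 u3 : V} (g1 : u1 ∈ R.wt 1 0) (g2 : u2 ∈ R.wt 0 1)
    (g3 : u3 ∈ R.wt 1 1) :
    R.e3 (R.f1 u1 + R.f2 u2 + R.f3 u3) + (R.f1 (R.e1 u3 - R.e3 u1) + R.f2 (R.e2 u3 - R.e3 u2) - (R.e1 u2 - R.e2 u1 - u3)) = R.c u3 := by
  obtain ⟨a1, a2⟩ := g1
  obtain ⟨b1, b2⟩ := g2
  obtain ⟨c1, c2⟩ := g3
  simp only [c_apply, map_add, map_sub, map_smul, map_neg, a1, a2, b1, b2, c1, c2, R.e1f1, R.e1f2, R.e1f3, R.e2f1, R.e2f2, R.e2f3, R.e3f1, R.e3f2, R.e3f3, R.e1e2,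
    R.e1e3, R.e2e3, R.f2f1, R.f1f3, R.f2f3, R.H1e1, R.H1e2, R.H1e3, R.H2e1, R.H2e2, R.H2e3,
    R.H1f1, R.H1f2, R.H1f3, R.H2f1, R.H2f2, R.H2f3, R.H1H2]
  push_cast
  module

lemma lap2_1 {w1 w2 w3 : V} (g1 : w1 ∈ R.wt 1 1) (g2 : w2 ∈ R.wt 2 1)
    (g3 : w3 ∈ R.wt 1 2) :
    (R.e1 (R.f1 w1 - R.f3 w3) - R.e2 (-R.f2 w1 - R.f3 w2) - (R.f1 w2 + R.f2 w3 - w1))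
     + R.f3 (R.e1 w3 - R.e2 w2 + R.e3 w1) = R.c w1 := by
  obtain ⟨a1, a2⟩ := g1
  obtain ⟨b1, b2⟩ := g2
  obtain ⟨c1, c2⟩ := g3
  simp only [c_apply, map_add, map_sub, map_smul, map_neg, a1, a2, b1, b2, c1, c2, R.e1f1, R.e1f2, R.e1f3, R.e2f1, R.e2f2, R.e2f3, R.e3f1, R.e3f2, R.e3f3, R.e1e2,
    R.e1e3, R.e2e3, R.f2f1, R.f1f3, R.f2f3, R.H1e1, R.H1e2, R.H1e3, R.H2e1, R.H2e2, R.H2e3,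
    R.H1f1, R.H1f2, R.H1f3, R.H2f1, R.H2f2, R.H2f3, R.H1H2]
  push_cast
  module

lemma lap2_2 {w1 w2 w3 : V} (g1 : w1 ∈ R.wt 1 1) (g2 : w2 ∈ R.wt 2 1)
    (g3 : w3 ∈ R.wt 1 2) :
    (R.e1 (R.f1 w2 + R.f2 w3 - w1) - R.e3 (-R.f2 w1 - R.f3 w2))
     + (-R.f2 (R.e1 w3 - R.e2 w2 + R.e3 w1)) = R.c w2 := by
  obtain ⟨a1, a2⟩ := g1
  obtain ⟨b1, b2⟩ := g2
  obtain ⟨c1, c2⟩ := g3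
  simp only [c_apply, map_add, map_sub, map_smul, map_neg, a1, a2, b1, b2, c1, c2, R.e1f1, R.e1f2, R.e1f3, R.e2f1, R.e2f2, R.e2f3, R.e3f1, R.e3f2, R.e3f3, R.e1e2,
    R.e1e3, R.e2e3, R.f2f1, R.f1f3, R.f2f3, R.H1e1, R.H1e2, R.H1e3, R.H2e1, R.H2e2, R.H2e3,
    R.H1f1, R.H1f2, R.H1f3, R.H2f1, R.H2f2, R.H2f3, R.H1H2]
  push_cast
  module

lemma lap2_3 {w1 w2 w3 : V} (g1 : w1 ∈ R.wt 1 1) (g2 : w2 ∈ R.wt 2 1)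
    (g3 : w3 ∈ R.wt 1 2) :
    (R.e2 (R.f1 w2 + R.f2 w3 - w1) - R.e3 (R.f1 w1 - R.f3 w3))
     + R.f1 (R.e1 w3 - R.e2 w2 + R.e3 w1) = R.c w3 := by
  obtain ⟨a1, a2⟩ := g1
  obtain ⟨b1, b2⟩ := g2
  obtain ⟨c1, c2⟩ := g3
  simp only [c_apply, map_add, map_sub, map_smul, map_neg, a1, a2, b1, b2, c1, c2, R.e1f1, R.e1f2, R.e1f3, R.e2f1, R.e2f2, R.e2f3, R.e3f1, R.e3f2, R.e3f3, R.e1e2,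
    R.e1e3, R.e2e3, R.f2f1, R.f1f3, R.f2f3, R.H1e1, R.H1e2, R.H1e3, R.H2e1, R.H2e2, R.H2e3,
    R.H1f1, R.H1f2, R.H1f3, R.H2f1, R.H2f2, R.H2f3, R.H1H2]
  push_cast
  module

/-- The differentials. -/
def d0 : V →ₗ[K] V × V × V := LinearMap.prod R.e1 (LinearMap.prod R.e2 R.e3)

def d1 : V × V × V →ₗ[K] V × V × V where
  toFun u := (R.e1 u.2.1 - R.e2 u.1 - u.2.2, R.e1 u.2.2 - R.e3 u.1, R.e2 u.2.2 - R.e3 u.2.1)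
  map_add' := by
    rintro ⟨a, b, c⟩ ⟨a', b', c'⟩
    ext <;> simp only [Prod.fst_add, Prod.snd_add, map_add] <;> abel
  map_smul' := by
    rintro r ⟨a, b, c⟩
    ext <;> simp [smul_sub]

def d2 : V × V × V →ₗ[K] V where
  toFun w := R.e1 w.2.2 - R.e2 w.2.1 + R.e3 w.1
  map_add' := by
    rintro ⟨a, b, c⟩ ⟨a', b', c'⟩
    simp only [Prod.fst_add, Prod.snd_add, map_add]; abel
  map_smul' := by
    rintro r ⟨a, b, c⟩
    simp [smul_sub]

lemma finrank_map_add {V W : Type*} [AddCommGroup V] [Module K V] [AddCommGroup W] [Module K W]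
    [FiniteDimensional K V] (f : V →ₗ[K] W) (A : Submodule K V) :
    Module.finrank K (A.map f) + Module.finrank K (A ⊓ LinearMap.ker f : Submodule K V)
      = Module.finrank K A := by
  have := LinearMap.finrank_range_add_finrank_ker (f.domRestrict A)
  rw [LinearMap.range_domRestrict] at this
  rw [← this]
  congr 1
  rw [LinearMap.ker_domRestrict]
  rw [← Submodule.finrank_map_subtype_eq A]
  exact congrArg (fun S : Submodule K V => Module.finrank K S)
    (Submodule.map_comap_subtype A (LinearMap.ker f)).symm

lemma finrank_prod_sub {V W : Type*} [AddCommGroup V] [Module K V] [AddCommGroup W] [Module K W]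
    [FiniteDimensional K V] [FiniteDimensional K W] (A : Submodule K V) (B : Submodule K W) :
    Module.finrank K (A.prod B) = Module.finrank K A + Module.finrank K B := by
  rw [← Module.finrank_prod]
  exact LinearEquiv.finrank_eq
    { toFun := fun x => (⟨x.1.1, x.2.1⟩, ⟨x.1.2, x.2.2⟩)
      invFun := fun x => ⟨(x.1.1, x.2.1), ⟨x.1.2, x.2.2⟩⟩
      map_add' := fun _ _ => rfl
      map_smul' := fun _ _ => rfl
      left_inv := fun _ => rfl
      right_inv := fun _ => rfl }

lemma exists_c [FiniteDimensional K V] {U : Submodule K V} (hU : R.Stable U)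
    (hc : ∀ v ∈ U, R.c v = 0 → v = 0) (m n : ℤ) {v : V} (hv : v ∈ U ⊓ R.wt m n) :
    ∃ v' ∈ U ⊓ R.wt m n, R.c v' = v := by
  have hmap : ∀ x ∈ U ⊓ R.wt m n, R.c x ∈ U ⊓ R.wt m n := fun x hx =>
    ⟨hU.c _ x hx.1, R.wt_c hx.2⟩
  have hinj : Function.Injective (R.c.restrict hmap) := by
    rw [injective_iff_map_eq_zero]
    rintro ⟨x, hx⟩ h
    have := congrArg Subtype.val h
    simp only [LinearMap.coe_restrict_apply, Submodule.coe_zero] at this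
    exact Subtype.ext (hc x hx.1 this)
  obtain ⟨⟨x, hx⟩, h⟩ := (LinearMap.injective_iff_surjective.mp hinj) ⟨v, hv⟩
  exact ⟨x, hx, congrArg Subtype.val h⟩

theorem euler_exact [FiniteDimensional K V] {U : Submodule K V} (hU : R.Stable U)
    (hc : ∀ v ∈ U, R.c v = 0 → v = 0) :
    (Module.finrank K (U ⊓ R.wt 0 0 : Submodule K V) : ℤ)
      - Module.finrank K (U ⊓ R.wt 1 0 : Submodule K V)
      - Module.finrank K (U ⊓ R.wt 0 1 : Submodule K V)
      + Module.finrank K (U ⊓ R.wt 2 1 : Submodule K V)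
      + Module.finrank K (U ⊓ R.wt 1 2 : Submodule K V)
      - Module.finrank K (U ⊓ R.wt 2 2 : Submodule K V) = 0 := by
  have hcc : ∀ x ∈ U, ∀ y ∈ U, R.c x = R.c y → x = y := by
    intro x hx y hy h
    have := hc (x - y) (U.sub_mem hx hy) (by rw [map_sub, h, sub_self])
    exact sub_eq_zero.mp this
  have E0 : (U ⊓ R.wt 0 0) ⊓ LinearMap.ker R.d0 = ⊥ := by
    rw [eq_bot_iff]
    rintro v ⟨⟨h1, h2⟩, h3⟩
    have h4 : R.e1 v = 0 ∧ R.e2 v = 0 ∧ R.e3 v = 0 := by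
      have : R.d0 v = 0 := h3
      simpa [d0] using this
    have := R.lap0 h2
    rw [h4.1, h4.2.1, h4.2.2] at this
    exact hc v h1 (by rw [← this]; simp)
  have E1 : (U ⊓ R.wt 0 0).map R.d0 =
      ((U ⊓ R.wt 1 0).prod ((U ⊓ R.wt 0 1).prod (U ⊓ R.wt 1 1))) ⊓ LinearMap.ker R.d1 := by
    apply le_antisymm
    · rintro _ ⟨v, ⟨h1, h2⟩, rfl⟩
      refine ⟨⟨⟨hU.e1 _ h1, R.wt_e1 h2 (by simp) (by simp)⟩,
        ⟨⟨hU.e2 _ h1, R.wt_e2 h2 (by simp) (by simp)⟩,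
          ⟨hU.e3 _ h1, R.wt_e3 h2 (by simp) (by simp)⟩⟩⟩, ?_⟩
      change R.d1 (R.e1 v, R.e2 v, R.e3 v) = 0
      simp only [d1, LinearMap.coe_mk, AddHom.coe_mk, R.e1e2, R.e1e3, R.e2e3]
      ext <;> simp
    · rintro ⟨u1, u2, u3⟩ ⟨⟨⟨g1, g2⟩, ⟨g3, g4⟩, g5, g6⟩, h⟩
      dsimp only at g1 g2 g3 g4 g5 g6
      have h' : R.e1 u2 - R.e2 u1 - u3 = 0 ∧ R.e1 u3 - R.e3 u1 = 0 ∧ R.e2 u3 - R.e3 u2 = 0 := by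
        have : R.d1 (u1, u2, u3) = 0 := h
        simpa [d1] using this
      obtain ⟨k1, k2, k3⟩ := h'
      have l1 := R.lap1_1 g2 g4 g6
      have l2 := R.lap1_2 g2 g4 g6
      have l3 := R.lap1_3 g2 g4 g6
      simp only [k1, k2, k3, map_zero, sub_zero, neg_zero, add_zero] at l1 l2 l3
      obtain ⟨v, hv, e⟩ := R.exists_c hU hc 0 0 (v := R.f1 u1 + R.f2 u2 + R.f3 u3)
        ⟨U.add_mem (U.add_mem (hU.f1 _ g1) (hU.f2 _ g3)) (hU.f3 _ g5),
          Submodule.add_mem _ (Submodule.add_mem _ (R.wt_f1 g2 (by simp) (by simp))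
            (R.wt_f2 g4 (by simp) (by simp))) (R.wt_f3 g6 (by simp) (by simp))⟩
      rw [← e] at l1 l2 l3
      rw [← R.c_e1] at l1
      rw [← R.c_e2] at l2
      rw [← R.c_e3] at l3
      refine ⟨v, hv, ?_⟩
      exact Prod.ext (hcc _ (hU.e1 _ hv.1) _ g1 l1) (Prod.ext (hcc _ (hU.e2 _ hv.1) _ g3 l2)
        (hcc _ (hU.e3 _ hv.1) _ g5 l3))
  have E2 : ((U ⊓ R.wt 1 0).prod ((U ⊓ R.wt 0 1).prod (U ⊓ R.wt 1 1))).map R.d1 =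
      ((U ⊓ R.wt 1 1).prod ((U ⊓ R.wt 2 1).prod (U ⊓ R.wt 1 2))) ⊓ LinearMap.ker R.d2 := by
    apply le_antisymm
    · rintro _ ⟨⟨u1, u2, u3⟩, ⟨⟨g1, g2⟩, ⟨g3, g4⟩, g5, g6⟩, rfl⟩
      dsimp only at g1 g2 g3 g4 g5 g6
      refine ⟨⟨⟨U.sub_mem (U.sub_mem (hU.e1 _ g3) (hU.e2 _ g1)) g5,
          Submodule.sub_mem _ (Submodule.sub_mem _ (R.wt_e1 g4 (by simp) (by simp))
            (R.wt_e2 g2 (by simp) (by simp))) g6⟩,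
        ⟨U.sub_mem (hU.e1 _ g5) (hU.e3 _ g1),
          Submodule.sub_mem _ (R.wt_e1 g6 (by simp) (by simp)) (R.wt_e3 g2 (by simp) (by simp))⟩,
        ⟨U.sub_mem (hU.e2 _ g5) (hU.e3 _ g3),
          Submodule.sub_mem _ (R.wt_e2 g6 (by simp) (by simp)) (R.wt_e3 g4 (by simp) (by simp))⟩⟩, ?_⟩
      change R.d2 (R.e1 u2 - R.e2 u1 - u3, R.e1 u3 - R.e3 u1, R.e2 u3 - R.e3 u2) = 0
      simp only [d2, LinearMap.coe_mk, AddHom.coe_mk, map_sub, R.e1e2, R.e1e3, R.e2e3]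
      abel
    · rintro ⟨w1, w2, w3⟩ ⟨⟨⟨g1, g2⟩, ⟨g3, g4⟩, g5, g6⟩, h⟩
      dsimp only at g1 g2 g3 g4 g5 g6
      have k : R.e1 w3 - R.e2 w2 + R.e3 w1 = 0 := h
      have l1 := R.lap2_1 g2 g4 g6
      have l2 := R.lap2_2 g2 g4 g6
      have l3 := R.lap2_3 g2 g4 g6
      simp only [k, map_zero, neg_zero, add_zero] at l1 l2 l3
      obtain ⟨u1, hu1, e1⟩ := R.exists_c hU hc 1 0 (v := -R.f2 w1 - R.f3 w2)
        ⟨U.sub_mem (U.neg_mem (hU.f2 _ g1)) (hU.f3 _ g3),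
          Submodule.sub_mem _ (Submodule.neg_mem _ (R.wt_f2 g2 (by simp) (by simp)))
            (R.wt_f3 g4 (by simp) (by simp))⟩
      obtain ⟨u2, hu2, e2⟩ := R.exists_c hU hc 0 1 (v := R.f1 w1 - R.f3 w3)
        ⟨U.sub_mem (hU.f1 _ g1) (hU.f3 _ g5),
          Submodule.sub_mem _ (R.wt_f1 g2 (by simp) (by simp))
            (R.wt_f3 g6 (by simp) (by simp))⟩
      obtain ⟨u3, hu3, e3⟩ := R.exists_c hU hc 1 1 (v := R.f1 w2 + R.f2 w3 - w1)
        ⟨U.sub_mem (U.add_mem (hU.f1 _ g3) (hU.f2 _ g5)) g1,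
          Submodule.sub_mem _ (Submodule.add_mem _ (R.wt_f1 g4 (by simp) (by simp))
            (R.wt_f2 g6 (by simp) (by simp))) g2⟩
      rw [← e1, ← e2, ← e3] at l1
      rw [← e1, ← e3] at l2
      rw [← e2, ← e3] at l3
      rw [← R.c_e1, ← R.c_e2, ← map_sub, ← map_sub] at l1
      rw [← R.c_e1, ← R.c_e3, ← map_sub] at l2
      rw [← R.c_e2, ← R.c_e3, ← map_sub] at l3
      refine ⟨(u1, u2, u3), ⟨hu1, hu2, hu3⟩, ?_⟩
      exact Prod.ext (hcc _ (U.sub_mem (U.sub_mem (hU.e1 _ hu2.1) (hU.e2 _ hu1.1)) hu3.1) _ g1 l1)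
        (Prod.ext (hcc _ (U.sub_mem (hU.e1 _ hu3.1) (hU.e3 _ hu1.1)) _ g3 l2)
        (hcc _ (U.sub_mem (hU.e2 _ hu3.1) (hU.e3 _ hu2.1)) _ g5 l3))
  have E3 : ((U ⊓ R.wt 1 1).prod ((U ⊓ R.wt 2 1).prod (U ⊓ R.wt 1 2))).map R.d2 =
      U ⊓ R.wt 2 2 := by
    apply le_antisymm
    · rintro _ ⟨⟨u1, u2, u3⟩, ⟨⟨g1, g2⟩, ⟨g3, g4⟩, g5, g6⟩, rfl⟩
      dsimp only at g1 g2 g3 g4 g5 g6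
      exact ⟨U.add_mem (U.sub_mem (hU.e1 _ g5) (hU.e2 _ g3)) (hU.e3 _ g1),
        Submodule.add_mem _ (Submodule.sub_mem _ (R.wt_e1 g6 (by simp) (by simp))
          (R.wt_e2 g4 (by simp) (by simp))) (R.wt_e3 g2 (by simp) (by simp))⟩
    · intro x hx
      obtain ⟨y, hy, rfl⟩ := R.exists_c hU hc 2 2 hx
      refine ⟨(R.f3 y, -R.f2 y, R.f1 y), ⟨⟨hU.f3 _ hy.1, R.wt_f3 hy.2 (by simp) (by simp)⟩,
        ⟨U.neg_mem (hU.f2 _ hy.1), Submodule.neg_mem _ (R.wt_f2 hy.2 (by simp) (by simp))⟩,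
        ⟨hU.f1 _ hy.1, R.wt_f1 hy.2 (by simp) (by simp)⟩⟩, R.lap3 hy.2⟩
  have F0 := finrank_map_add R.d0 (U ⊓ R.wt 0 0)
  have F1 := finrank_map_add R.d1 ((U ⊓ R.wt 1 0).prod ((U ⊓ R.wt 0 1).prod (U ⊓ R.wt 1 1)))
  have F2 := finrank_map_add R.d2 ((U ⊓ R.wt 1 1).prod ((U ⊓ R.wt 2 1).prod (U ⊓ R.wt 1 2)))
  rw [E0, E1, finrank_bot] at F0
  rw [E2] at F1
  rw [E3] at F2
  simp only [finrank_prod_sub] at F1 F2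
  omega

lemma dominant [FiniteDimensional K V] [CharZero K] {m n : ℤ} {v : V} (hv : v ∈ R.wt m n) (h0 : v ≠ 0)
    (he : R.e3 v = 0) : 0 ≤ m + n := by
  by_cases hh : R.H1 + R.H2 = 0
  · have : (R.H1 + R.H2) v = 0 := by rw [hh]; rfl
    rw [LinearMap.add_apply, hv.1, hv.2, ← add_smul] at this
    have h2 := (smul_eq_zero.mp this).resolve_right h0
    have : m + n = 0 := by exact_mod_cast h2
    omega
  · let _ : LieRing (Module.End K V) := LieRing.ofAssociativeRing
    have t : IsSl2Triple (R.H1 + R.H2) R.e3 R.f3 := by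
      refine ⟨hh, ?_, ?_, ?_⟩
      · ext x
        simp [Module.End.lie_apply, Ring.lie_def, R.e3f3, add_assoc]
      · ext x
        simp only [Ring.lie_def, LinearMap.sub_apply, Module.End.mul_apply, LinearMap.add_apply,
          R.H1e3, R.H2e3, map_add, LinearMap.smul_apply]
        module
      · ext x
        simp only [Ring.lie_def, LinearMap.sub_apply, Module.End.mul_apply, LinearMap.add_apply,
          R.H1f3, R.H2f3, map_add, LinearMap.smul_apply, LinearMap.neg_apply]
        module
    have p : t.HasPrimitiveVectorWith v ((m : K) + n) := by
      refine ⟨h0, ?_, ?_⟩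
      · change (R.H1 + R.H2) v = _
        rw [LinearMap.add_apply, hv.1, hv.2, ← add_smul]
      · exact he
    obtain ⟨k, hk⟩ := p.exists_nat
    have : m + n = k := by exact_mod_cast hk
    omega

lemma antidominant [FiniteDimensional K V] [CharZero K] {m n : ℤ} {v : V} (hv : v ∈ R.wt m n) (h0 : v ≠ 0)
    (he : R.f3 v = 0) : m + n ≤ 0 := by
  by_cases hh : -(R.H1 + R.H2) = 0
  · have : (-(R.H1 + R.H2)) v = 0 := by rw [hh]; rfl
    rw [LinearMap.neg_apply, LinearMap.add_apply, hv.1, hv.2, ← add_smul, neg_eq_zero] at this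
    have h2 := (smul_eq_zero.mp this).resolve_right h0
    have : m + n = 0 := by exact_mod_cast h2
    omega
  · let _ : LieRing (Module.End K V) := LieRing.ofAssociativeRing
    have t : IsSl2Triple (-(R.H1 + R.H2)) R.f3 R.e3 := by
      refine ⟨hh, ?_, ?_, ?_⟩
      · ext x
        simp [Ring.lie_def, R.e3f3, add_assoc]
      · ext x
        simp only [Ring.lie_def, LinearMap.sub_apply, Module.End.mul_apply, LinearMap.add_apply,
          R.H1f3, R.H2f3, map_add, LinearMap.smul_apply, LinearMap.neg_apply, map_neg]
        module
      · ext x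
        simp only [Ring.lie_def, LinearMap.sub_apply, Module.End.mul_apply, LinearMap.add_apply,
          R.H1e3, R.H2e3, map_add, LinearMap.smul_apply, LinearMap.neg_apply, map_neg]
        module
    have p : t.HasPrimitiveVectorWith v (-((m : K) + n)) := by
      refine ⟨h0, ?_, ?_⟩
      · change (-(R.H1 + R.H2)) v = _
        rw [LinearMap.neg_apply, LinearMap.add_apply, hv.1, hv.2, ← add_smul, neg_smul]
      · exact he
    obtain ⟨k, hk⟩ := p.exists_nat
    have : -(m + n) = k := by exact_mod_cast hk
    omega

lemma Stable.ker (N : ℕ) : R.Stable (LinearMap.ker (R.c ^ N)) := by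
  have key : ∀ X : Module.End K V, (∀ v, R.c (X v) = X (R.c v)) →
      ∀ v ∈ LinearMap.ker (R.c ^ N), X v ∈ LinearMap.ker (R.c ^ N) := by
    intro X hX v hv
    have hcomm : Commute (R.c ^ N) X :=
      Commute.pow_left (LinearMap.ext hX : R.c * X = X * R.c) N
    rw [LinearMap.mem_ker] at hv ⊢
    rw [← Module.End.mul_apply, hcomm.eq, Module.End.mul_apply, hv, map_zero]
  exact ⟨key _ R.c_e1, key _ R.c_e2, key _ R.c_e3, key _ R.c_f1, key _ R.c_f2, key _ R.c_f3,
    key _ R.c_H1, key _ R.c_H2⟩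

lemma Stable.range (N : ℕ) : R.Stable (LinearMap.range (R.c ^ N)) := by
  have key : ∀ X : Module.End K V, (∀ v, R.c (X v) = X (R.c v)) →
      ∀ v ∈ LinearMap.range (R.c ^ N), X v ∈ LinearMap.range (R.c ^ N) := by
    rintro X hX _ ⟨v, rfl⟩
    have hcomm : Commute (R.c ^ N) X :=
      Commute.pow_left (LinearMap.ext hX : R.c * X = X * R.c) N
    exact ⟨X v, by rw [← Module.End.mul_apply, hcomm.eq, Module.End.mul_apply]⟩
  exact ⟨key _ R.c_e1, key _ R.c_e2, key _ R.c_e3, key _ R.c_f1, key _ R.c_f2, key _ R.c_f3,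
    key _ R.c_H1, key _ R.c_H2⟩

lemma c_pow_eq {v : V} {r : K} (h : R.c v = r • v) (N : ℕ) : (R.c ^ N) v = r ^ N • v := by
  induction N with
  | zero => simp
  | succ k ih => rw [pow_succ', Module.End.mul_apply, ih, map_smul, h, smul_smul, pow_succ]

lemma ker_weight [FiniteDimensional K V] [CharZero K] (N : ℕ) {m n : ℤ} {v : V}
    (hv : v ∈ LinearMap.ker (R.c ^ N) ⊓ R.wt m n) (h0 : v ≠ 0) : m = 0 ∧ n = 0 := by
  set W := LinearMap.ker (R.c ^ N) with hW
  have hS : R.Stable W := Stable.ker R N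
  let S : Set ℤ := {h | ∃ m n : ℤ, ∃ v ∈ W ⊓ R.wt m n, v ≠ 0 ∧ m + n = h}
  have hfin : S.Finite := by
    have h1 := Module.End.finite_hasEigenvalue (R.H1 + R.H2)
    have h2 : ((fun z : ℤ => (z : K)) ⁻¹' {μ | (R.H1 + R.H2).HasEigenvalue μ}).Finite :=
      h1.preimage (Int.cast_injective.injOn)
    apply h2.subset
    rintro h ⟨m, n, v, hv, hv0, rfl⟩
    apply Module.End.hasEigenvalue_of_hasEigenvector (x := v)
    rw [Module.End.hasEigenvector_iff, Module.End.mem_eigenspace_iff]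
    refine ⟨?_, hv0⟩
    rw [LinearMap.add_apply, hv.2.1, hv.2.2, ← add_smul]
    push_cast
    rfl
  have hne : S.Nonempty := ⟨m + n, m, n, v, hv, h0, rfl⟩
  obtain ⟨M, hM, hmax⟩ := Set.exists_max_image S id hfin hne
  obtain ⟨L, hL, hmin⟩ := Set.exists_min_image S id hfin hne
  simp only [id] at hmax hmin
  have top : ∀ m n : ℤ, ∀ v ∈ W ⊓ R.wt m n, v ≠ 0 → m + n = M → m = 0 ∧ n = 0 := by
    rintro m n v ⟨hv1, hv2⟩ hv0 hmn
    have k1 : R.e1 v = 0 := by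
      by_contra h
      have := hmax _ ⟨_, _, _, ⟨hS.e1 _ hv1, R.wt_e1 hv2 rfl rfl⟩, h, rfl⟩
      omega
    have k2 : R.e2 v = 0 := by
      by_contra h
      have := hmax _ ⟨_, _, _, ⟨hS.e2 _ hv1, R.wt_e2 hv2 rfl rfl⟩, h, rfl⟩
      omega
    have k3 : R.e3 v = 0 := by
      by_contra h
      have := hmax _ ⟨_, _, _, ⟨hS.e3 _ hv1, R.wt_e3 hv2 rfl rfl⟩, h, rfl⟩
      omega
    have hd := R.dominant hv2 hv0 k3
    have hcv : R.c v = ((m * m - n * m + n * n + m + n : ℤ) : K) • v := by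
      rw [c_apply, k1, k2, k3, hv2.1, hv2.2]
      simp only [map_smul, hv2.1, hv2.2, map_zero]
      push_cast
      module
    have h2 := R.c_pow_eq hcv N
    rw [show (R.c ^ N) v = 0 from hv1] at h2
    have h3 := (smul_eq_zero.mp h2.symm).resolve_right hv0
    have h4 : m * m - n * m + n * n + m + n = 0 := by
      have := eq_zero_of_pow_eq_zero h3
      exact_mod_cast this
    have h5 : m * m - n * m + n * n ≤ 0 := by omega
    have h6 : m = 0 := by nlinarith [sq_nonneg (2 * n - m), sq_nonneg m, sq_nonneg n]
    subst h6
    have h7 : n = 0 := by nlinarith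
    exact ⟨rfl, h7⟩
  have bot : ∀ m n : ℤ, ∀ v ∈ W ⊓ R.wt m n, v ≠ 0 → m + n = L → m = 0 ∧ n = 0 := by
    rintro m n v ⟨hv1, hv2⟩ hv0 hmn
    have k1 : R.f1 v = 0 := by
      by_contra h
      have := hmin _ ⟨_, _, _, ⟨hS.f1 _ hv1, R.wt_f1 hv2 rfl rfl⟩, h, rfl⟩
      omega
    have k2 : R.f2 v = 0 := by
      by_contra h
      have := hmin _ ⟨_, _, _, ⟨hS.f2 _ hv1, R.wt_f2 hv2 rfl rfl⟩, h, rfl⟩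
      omega
    have k3 : R.f3 v = 0 := by
      by_contra h
      have := hmin _ ⟨_, _, _, ⟨hS.f3 _ hv1, R.wt_f3 hv2 rfl rfl⟩, h, rfl⟩
      omega
    have hd := R.antidominant hv2 hv0 k3
    have hcv : R.c v = ((m * m - n * m + n * n - m - n : ℤ) : K) • v := by
      have q1 := R.e1f1 v
      have q2 := R.e2f2 v
      have q3 := R.e3f3 v
      rw [k1, map_zero, hv2.1, hv2.2] at q1
      rw [k2, map_zero, hv2.1, hv2.2] at q2
      rw [k3, map_zero, hv2.1, hv2.2] at q3
      rw [c_apply, hv2.1, hv2.2]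
      simp only [map_smul, hv2.1, hv2.2, map_zero]
      push_cast
      linear_combination (norm := module) -q1 - q2 - q3
    have h2 := R.c_pow_eq hcv N
    rw [show (R.c ^ N) v = 0 from hv1] at h2
    have h3 := (smul_eq_zero.mp h2.symm).resolve_right hv0
    have h4 : m * m - n * m + n * n - m - n = 0 := by
      have := eq_zero_of_pow_eq_zero h3
      exact_mod_cast this
    have h5 : m * m - n * m + n * n ≤ 0 := by omega
    have h6 : m = 0 := by nlinarith [sq_nonneg (2 * n - m), sq_nonneg m, sq_nonneg n]
    subst h6
    have h7 : n = 0 := by nlinarith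
    exact ⟨rfl, h7⟩
  have hM0 : M = 0 := by
    obtain ⟨m, n, v, hv, hv0, h⟩ := hM
    have := top m n v hv hv0 h
    omega
  have hL0 : L = 0 := by
    obtain ⟨m, n, v, hv, hv0, h⟩ := hL
    have := bot m n v hv hv0 h
    omega
  have b1 := hmax (m + n) ⟨m, n, v, hv, h0, rfl⟩
  have b2 := hmin (m + n) ⟨m, n, v, hv, h0, rfl⟩
  exact top m n v hv h0 (by omega)

theorem finrank_inv [FiniteDimensional K V] [CharZero K] :
    (Module.finrank K R.inv : ℤ) = Module.finrank K (R.wt 0 0) - Module.finrank K (R.wt 1 0)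
      - Module.finrank K (R.wt 0 1) + Module.finrank K (R.wt 2 1)
      + Module.finrank K (R.wt 1 2) - Module.finrank K (R.wt 2 2) := by
  obtain ⟨N, hN, hN1⟩ := ((LinearMap.eventually_isCompl_ker_pow_range_pow R.c).and
    (Filter.eventually_ge_atTop 1)).exists
  set W := LinearMap.ker (R.c ^ N) with hW
  set U := LinearMap.range (R.c ^ N) with hU
  have sW : R.Stable W := Stable.ker R N
  have sU : R.Stable U := Stable.range R N
  have split : ∀ m n : ℤ, Module.finrank K (R.wt m n) =
      Module.finrank K (W ⊓ R.wt m n : Submodule K V)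
        + Module.finrank K (U ⊓ R.wt m n : Submodule K V) := by
    intro m n
    rw [← Submodule.finrank_sup_add_finrank_inf_eq]
    have i0 : (W ⊓ R.wt m n) ⊓ (U ⊓ R.wt m n) = ⊥ := by
      rw [eq_bot_iff, ← hN.inf_eq_bot]
      exact inf_le_inf inf_le_left inf_le_left
    rw [i0, finrank_bot, add_zero]
    refine congrArg (fun S : Submodule K V => Module.finrank K S) ?_
    apply le_antisymm
    · intro v hv
      have : v ∈ W ⊔ U := by rw [hN.sup_eq_top]; trivial
      obtain ⟨w, hw, u, hu, rfl⟩ := Submodule.mem_sup.mp this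
      have key : ∀ (X : Module.End K V) (r : K), (∀ v ∈ W, X v ∈ W) → (∀ v ∈ U, X v ∈ U) →
          X (w + u) = r • (w + u) → X w = r • w ∧ X u = r • u := by
        intro X r hXW hXU h
        rw [map_add, smul_add] at h
        have h1 : X w - r • w = r • u - X u := by
          linear_combination (norm := module) h
        have h2 : X w - r • w ∈ W := W.sub_mem (hXW _ hw) (W.smul_mem _ hw)
        have h3 : X w - r • w ∈ U := by
          rw [h1]; exact U.sub_mem (U.smul_mem _ hu) (hXU _ hu)
        have h4 : X w - r • w ∈ W ⊓ U := ⟨h2, h3⟩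
        rw [hN.inf_eq_bot, Submodule.mem_bot] at h4
        refine ⟨sub_eq_zero.mp h4, ?_⟩
        rw [h4] at h1
        exact (sub_eq_zero.mp h1.symm).symm
      have a1 := key R.H1 m sW.H1 sU.H1 hv.1
      have a2 := key R.H2 n sW.H2 sU.H2 hv.2
      exact Submodule.mem_sup.mpr ⟨w, ⟨hw, a1.1, a2.1⟩, u, ⟨hu, a1.2, a2.2⟩, rfl⟩
    · exact sup_le inf_le_right inf_le_right
  have hz : ∀ m n : ℤ, ¬ (m = 0 ∧ n = 0) →
      Module.finrank K (W ⊓ R.wt m n : Submodule K V) = 0 := by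
    intro m n hmn
    have : W ⊓ R.wt m n = ⊥ := by
      rw [eq_bot_iff]
      intro v hv
      by_contra h0
      exact hmn (R.ker_weight N hv h0)
    rw [this, finrank_bot]
  have hinv : R.inv = W ⊓ R.wt 0 0 := by
    apply le_antisymm
    · rintro v ⟨h1, h2, h3, h4, h5, h6⟩
      have q1 := R.e1f1 v
      have q2 := R.e2f2 v
      rw [h1, h4, map_zero, map_zero, zero_add] at q1
      rw [h2, h5, map_zero, map_zero, zero_add] at q2
      have k1 : (3 : K) • R.H1 v = 0 := by
        linear_combination (norm := module) (-2 : K) • q1 - q2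
      have k2 : (3 : K) • R.H2 v = 0 := by
        linear_combination (norm := module) (-2 : K) • q2 - q1
      have t : (3 : K) ≠ 0 := by norm_num
      have k1' := (smul_eq_zero.mp k1).resolve_left t
      have k2' := (smul_eq_zero.mp k2).resolve_left t
      refine ⟨?_, by simp [mem_wt, k1', k2']⟩
      have hc : R.c v = 0 := by
        rw [c_apply, h1, h2, h3, k1', k2']; simp
      obtain ⟨k, rfl⟩ := Nat.exists_eq_add_of_le hN1
      change (R.c ^ (1 + k)) v = 0
      rw [add_comm, pow_succ, Module.End.mul_apply, hc, map_zero]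
    · rintro v ⟨h1, h2⟩
      have z : ∀ m n : ℤ, ¬ (m = 0 ∧ n = 0) → ∀ x ∈ W ⊓ R.wt m n, x = 0 := by
        intro m n hmn x hx
        by_contra h0
        exact hmn (R.ker_weight N hx h0)
      exact ⟨z 1 0 (by simp) _ ⟨sW.e1 _ h1, R.wt_e1 h2 (by simp) (by simp)⟩,
        z 0 1 (by simp) _ ⟨sW.e2 _ h1, R.wt_e2 h2 (by simp) (by simp)⟩,
        z 1 1 (by simp) _ ⟨sW.e3 _ h1, R.wt_e3 h2 (by simp) (by simp)⟩,
        z (-1) 0 (by simp) _ ⟨sW.f1 _ h1, R.wt_f1 h2 (by simp) (by simp)⟩,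
        z 0 (-1) (by simp) _ ⟨sW.f2 _ h1, R.wt_f2 h2 (by simp) (by simp)⟩,
        z (-1) (-1) (by simp) _ ⟨sW.f3 _ h1, R.wt_f3 h2 (by simp) (by simp)⟩⟩
  have hcU : ∀ v ∈ U, R.c v = 0 → v = 0 := by
    intro v hv h
    have : v ∈ W ⊓ U := by
      refine ⟨?_, hv⟩
      obtain ⟨k, rfl⟩ := Nat.exists_eq_add_of_le hN1
      change (R.c ^ (1 + k)) v = 0
      rw [add_comm, pow_succ, Module.End.mul_apply, h, map_zero]
    rwa [hN.inf_eq_bot, Submodule.mem_bot] at this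
  have E := R.euler_exact sU hcU
  rw [hinv]
  have s00 := split 0 0
  have s10 := split 1 0
  have s01 := split 0 1
  have s21 := split 2 1
  have s12 := split 1 2
  have s22 := split 2 2
  have z10 := hz 1 0 (by simp)
  have z01 := hz 0 1 (by simp)
  have z21 := hz 2 1 (by simp)
  have z12 := hz 1 2 (by simp)
  have z22 := hz 2 2 (by simp)
  omega

end GlRep

namespace TR
variable {K : Type*} [Field K]

/-- polynomial ring on pairs -/
abbrev PP (K : Type*) [Field K] := MvPolynomial (MatVar 3) K
/-- matrices of polynomials -/
abbrev MM (K : Type*) [Field K] := Matrix (Fin 3) (Fin 3) (PP K)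
/-- scalar matrices -/
abbrev M3 (K : Type*) [Field K] := Matrix (Fin 3) (Fin 3) K

def gX (K : Type*) [Field K] : MM K := Matrix.of fun i j => X (Sum.inl (i, j))
def gY (K : Type*) [Field K] : MM K := Matrix.of fun i j => X (Sum.inr (i, j))
def Ec (E : M3 K) : MM K := E.map C

def Dval (E : M3 K) : MatVar 3 → PP K
  | Sum.inl ij => (gX K * Ec E - Ec E * gX K) ij.1 ij.2
  | Sum.inr ij => (gY K * Ec E - Ec E * gY K) ij.1 ij.2

def DD (E : M3 K) : Derivation K (PP K) (PP K) := mkDerivation K (Dval E)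

lemma map_D_mul (D : Derivation K (PP K) (PP K)) (M N : MM K) :
    (M * N).map D = M.map D * N + M * N.map D := by
  ext1 i j
  simp only [Matrix.map_apply, Matrix.mul_apply, Matrix.add_apply, map_sum, Derivation.leibniz,
    ← Finset.sum_add_distrib, smul_eq_mul]
  refine Finset.sum_congr rfl fun k _ => ?_
  ring

lemma map_D_add (D : Derivation K (PP K) (PP K)) (M N : MM K) :
    (M + N).map D = M.map D + N.map D := by
  ext1 i j; simp

lemma map_D_sub (D : Derivation K (PP K) (PP K)) (M N : MM K) :
    (M - N).map D = M.map D - N.map D := by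
  ext1 i j; simp

lemma map_D_Ec (D : Derivation K (PP K) (PP K)) (E : M3 K) : (Ec E).map D = 0 := by
  ext1 i j; simp [Ec]

lemma Ec_mul (E F : M3 K) : Ec (E * F) = Ec E * Ec F := by simp [Ec, Matrix.map_mul]
lemma Ec_sub (E F : M3 K) : Ec (E - F) = Ec E - Ec F := by ext1 i j; simp [Ec]
lemma Ec_add (E F : M3 K) : Ec (E + F) = Ec E + Ec F := by ext1 i j; simp [Ec]
lemma Ec_smul (c : K) (E : M3 K) : Ec (c • E) = c • Ec E := by
  ext1 i j; simp [Ec, MvPolynomial.smul_eq_C_mul]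

lemma gX_D (E : M3 K) : (gX K).map (DD E) = gX K * Ec E - Ec E * gX K := by
  ext1 i j; simp [gX, DD, mkDerivation_X, Dval]
lemma gY_D (E : M3 K) : (gY K).map (DD E) = gY K * Ec E - Ec E * gY K := by
  ext1 i j; simp [gY, DD, mkDerivation_X, Dval]

lemma DD_bracket (E F : M3 K) : ⁅DD E, DD F⁆ = DD (E * F - F * E) := by
  have hX : ((gX K).map (DD F)).map (DD E) - ((gX K).map (DD E)).map (DD F)
      = (gX K).map (DD (E * F - F * E)) := by
    simp only [gX_D, map_D_sub, map_D_mul, map_D_Ec, Ec_sub, Ec_mul]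
    noncomm_ring
  have hY : ((gY K).map (DD F)).map (DD E) - ((gY K).map (DD E)).map (DD F)
      = (gY K).map (DD (E * F - F * E)) := by
    simp only [gY_D, map_D_sub, map_D_mul, map_D_Ec, Ec_sub, Ec_mul]
    noncomm_ring
  refine derivation_ext fun v => ?_
  rw [Derivation.commutator_apply]
  rcases v with ⟨i, j⟩ | ⟨i, j⟩
  · simpa [gX] using congrFun (congrFun hX i) j
  · simpa [gY] using congrFun (congrFun hY i) j

lemma DD_add (E F : M3 K) : DD (E + F) = DD E + DD F := by
  refine derivation_ext fun v => ?_
  rcases v with ⟨i, j⟩ | ⟨i, j⟩ <;>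
  · simp only [DD, Dval, mkDerivation_X, Derivation.add_apply, Ec_add, mul_add, add_mul, Matrix.sub_apply, Matrix.add_apply]
    ring

lemma DD_smul (c : K) (E : M3 K) : DD (c • E) = c • DD E := by
  refine derivation_ext fun v => ?_
  rcases v with ⟨i, j⟩ | ⟨i, j⟩ <;>
  · simp only [DD, Dval, mkDerivation_X, Derivation.smul_apply, Ec_smul, Matrix.mul_smul, Matrix.smul_mul, Matrix.sub_apply, Matrix.smul_apply, smul_sub]

/-- The infinitesimal action. -/
def dl (E : M3 K) : Module.End K (MM K) where
  toFun M := M.map (DD E) + (Ec E * M - M * Ec E)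
  map_add' M N := by
    simp only [map_D_add, mul_add, add_mul]; abel
  map_smul' c M := by
    have : (c • M).map (DD E) = c • M.map (DD E) := by ext1 i j; simp
    simp only [this, Matrix.mul_smul, Matrix.smul_mul, RingHom.id_apply, smul_add, smul_sub]

lemma dl_apply (E : M3 K) (M : MM K) : dl E M = M.map (DD E) + (Ec E * M - M * Ec E) := rfl

lemma dl_add (E F : M3 K) : dl (E + F) = dl E + dl F := by
  refine LinearMap.ext fun M => ?_
  have : M.map (DD E + DD F) = M.map (DD E) + M.map (DD F) := by ext1 i j; simp
  simp only [LinearMap.add_apply, dl_apply, DD_add, Ec_add, this, add_mul, mul_add]; abel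

lemma dl_smul (c : K) (E : M3 K) : dl (c • E) = c • dl E := by
  refine LinearMap.ext fun M => ?_
  have : M.map (c • DD E) = c • M.map (DD E) := by ext1 i j; simp
  simp only [LinearMap.smul_apply, dl_apply, DD_smul, Ec_smul, this, Matrix.mul_smul, Matrix.smul_mul, smul_add, smul_sub]

lemma dl_bracket (E F : M3 K) (M : MM K) :
    dl E (dl F M) = dl F (dl E M) + dl (E * F - F * E) M := by
  have h : M.map (DD (E * F - F * E)) = (M.map (DD F)).map (DD E) - (M.map (DD E)).map (DD F) := by
    ext1 i j
    simp only [← DD_bracket, Matrix.map_apply, Matrix.sub_apply, Derivation.commutator_apply]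
  simp only [dl_apply, h, map_D_sub, map_D_add, map_D_mul, map_D_Ec, Ec_sub, Ec_mul]
  noncomm_ring

/-- A version usable for the table of relations. -/
lemma dl_rel (E F G : M3 K) (h : E * F - F * E = G) (M : MM K) :
    dl E (dl F M) = dl F (dl E M) + dl G M := h ▸ dl_bracket E F M
lemma dl_zero : dl (0 : M3 K) = 0 := by
  have := dl_smul (0 : K) (0 : M3 K)
  simpa using this

lemma Dval_hom (E : M3 K) (v : MatVar 3) : (Dval E v).IsWeightedHomogeneous (bideg 3) (bideg 3 v) := by
  have key : ∀ (s : Fin 3 × Fin 3 → MatVar 3) (hs : ∀ ij, bideg 3 (s ij) = bideg 3 v) (i j : Fin 3),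
      (∑ k, (X (s (i, k)) : PP K) * C (E k j) - ∑ k, C (E i k) * X (s (k, j))).IsWeightedHomogeneous (bideg 3)
        (bideg 3 v) := by
    intro s hs i j
    refine (weightedHomogeneousSubmodule K (bideg 3) (bideg 3 v)).sub_mem ?_ ?_
    · refine Submodule.sum_mem _ fun k _ => ?_
      have := (isWeightedHomogeneous_X K (bideg 3) (s (i, k))).mul (isWeightedHomogeneous_C (bideg 3) (E k j))
      rw [add_zero, hs] at this; exact this
    · refine Submodule.sum_mem _ fun k _ => ?_
      have := (isWeightedHomogeneous_C (bideg 3) (E i k)).mul (isWeightedHomogeneous_X K (bideg 3) (s (k, j)))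
      rw [zero_add, hs] at this; exact this
  rcases v with ⟨i, j⟩ | ⟨i, j⟩
  · exact key Sum.inl (fun _ => rfl) i j
  · exact key Sum.inr (fun _ => rfl) i j

lemma DD_hom (E : M3 K) (f : PP K) (m : ℕ × ℕ) (hf : f.IsWeightedHomogeneous (bideg 3) m) :
    (DD E f).IsWeightedHomogeneous (bideg 3) m := by
  rw [f.as_sum, map_sum]
  refine Submodule.sum_mem (weightedHomogeneousSubmodule K (bideg 3) m) fun d hd => ?_
  have hw : Finsupp.weight (bideg 3) d = m := hf (by simpa using hd)
  rw [DD, mkDerivation_monomial]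
  refine Submodule.smul_mem _ _ (Submodule.sum_mem _ fun v hv => ?_)
  have h1 : d - Finsupp.single v 1 + Finsupp.single v 1 = d := by
    ext u
    have := Finsupp.mem_support_iff.1 hv
    by_cases h : v = u
    · subst h; simp; omega
    · simp [Finsupp.single_apply, h]
  have h2 := (isWeightedHomogeneous_monomial (bideg 3) (d - Finsupp.single v 1) ((d v : ℕ) : K) rfl).mul (Dval_hom E v)
  have h3 : Finsupp.weight (bideg 3) (d - Finsupp.single v 1) + bideg 3 v = m := by
    rw [← hw]; conv_rhs => rw [← h1, map_add, Finsupp.weight_single, one_smul]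
  rw [h3] at h2
  exact h2

/-- value of a root on a diagonal matrix. -/
def rtK (h : Fin 3 → K) : MatVar 3 → K
  | Sum.inl ij => h ij.1 - h ij.2
  | Sum.inr ij => h ij.1 - h ij.2

lemma Dval_diag (h : Fin 3 → K) (v : MatVar 3) :
    Dval (Matrix.diagonal h) v = C (-(rtK h v)) * X v := by
  have : Ec (Matrix.diagonal h) = Matrix.diagonal (fun i => C (h i)) := by
    simp [Ec, Matrix.diagonal_map]
  rcases v with ⟨i, j⟩ | ⟨i, j⟩ <;>
  · simp [Dval, this, Matrix.mul_diagonal, Matrix.diagonal_mul, gX, gY, rtK]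
    ring

lemma DD_diag_monomial (h : Fin 3 → K) (d : MatVar 3 →₀ ℕ) (r : K) :
    DD (Matrix.diagonal h) (monomial d r) = monomial d (-(Finsupp.weight (rtK h) d) * r) := by
  rw [DD, mkDerivation_monomial, Finsupp.sum]
  have : ∀ v ∈ d.support, (monomial (d - Finsupp.single v 1)) ((d v : ℕ) : K) • Dval (Matrix.diagonal h) v
      = monomial d (-(d v • rtK h v)) := by
    intro v hv
    have h1 : d - Finsupp.single v 1 + Finsupp.single v 1 = d := by
      ext u
      have := Finsupp.mem_support_iff.1 hv
      by_cases h : v = u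
      · subst h; simp; omega
      · simp [Finsupp.single_apply, h]
    rw [Dval_diag, C_mul_X_eq_monomial, smul_eq_mul, monomial_mul, h1]
    congr 1; simp
  rw [Finset.sum_congr rfl this, ← map_sum, MvPolynomial.smul_monomial]
  congr 1
  rw [Finsupp.weight_apply, Finsupp.sum, Finset.sum_neg_distrib, smul_eq_mul, mul_comm]

lemma coeff_DD_diag (h : Fin 3 → K) (d : MatVar 3 →₀ ℕ) (f : PP K) :
    coeff d (DD (Matrix.diagonal h) f) = -(Finsupp.weight (rtK h) d) * coeff d f := by
  classical
  induction f using MvPolynomial.induction_on' with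
  | monomial u a =>
    rw [DD_diag_monomial, coeff_monomial, coeff_monomial]
    split_ifs with hh
    · rw [hh]
    · simp
  | add p q hp hq => rw [map_add, coeff_add, coeff_add, hp, hq]; ring

lemma coeff_dl_diag (h : Fin 3 → K) (d : MatVar 3 →₀ ℕ) (M : MM K) (i j : Fin 3) :
    coeff d (dl (Matrix.diagonal h) M i j) = (h i - h j - Finsupp.weight (rtK h) d) * coeff d (M i j) := by
  have : Ec (Matrix.diagonal h) = Matrix.diagonal (fun i => C (h i)) := by
    simp [Ec, Matrix.diagonal_map]
  rw [dl_apply, this]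
  simp only [Matrix.add_apply, Matrix.sub_apply, Matrix.mul_diagonal, Matrix.diagonal_mul, Matrix.map_apply,
    coeff_add, coeff_sub, coeff_DD_diag, coeff_C_mul, mul_comm (M i j) (C (h j))]
  ring

/-- The homogeneous component. -/
def VV (K : Type*) [Field K] (p q : ℕ) : Submodule K (MM K) where
  carrier := {M | ∀ i j, (M i j).IsWeightedHomogeneous (bideg 3) (p, q)}
  add_mem' := fun ha hb i j => (weightedHomogeneousSubmodule K (bideg 3) (p, q)).add_mem (ha i j) (hb i j)
  zero_mem' := fun i j => (weightedHomogeneousSubmodule K (bideg 3) (p, q)).zero_mem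
  smul_mem' := fun c _ ha i j => (weightedHomogeneousSubmodule K (bideg 3) (p, q)).smul_mem c (ha i j)

lemma mem_VV {p q : ℕ} {M : MM K} :
    M ∈ VV K p q ↔ ∀ i j, (M i j).IsWeightedHomogeneous (bideg 3) (p, q) := Iff.rfl

lemma dl_mem (E : M3 K) (p q : ℕ) (M : MM K) (hM : M ∈ VV K p q) : dl E M ∈ VV K p q := by
  intro i j
  refine (weightedHomogeneousSubmodule K (bideg 3) (p, q)).add_mem (DD_hom E _ _ (hM i j)) ?_
  refine (weightedHomogeneousSubmodule K (bideg 3) (p, q)).sub_mem ?_ ?_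
  · rw [Matrix.mul_apply]
    refine Submodule.sum_mem _ fun k _ => ?_
    have := (isWeightedHomogeneous_C (bideg 3) (E i k)).mul (hM k j)
    rw [zero_add] at this; exact this
  · rw [Matrix.mul_apply]
    refine Submodule.sum_mem _ fun k _ => ?_
    have := (hM i k).mul (isWeightedHomogeneous_C (bideg 3) (E k j))
    rw [add_zero] at this; exact this

/-- restricted operator -/
def dr (p q : ℕ) (E : M3 K) : Module.End K (VV K p q) := (dl E).restrict (dl_mem E p q)

lemma dr_add (p q : ℕ) (E F : M3 K) : dr p q (E + F) = dr p q E + dr p q F := by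
  refine LinearMap.ext fun M => Subtype.ext ?_
  exact LinearMap.congr_fun (dl_add E F) M.1
lemma dr_smul (p q : ℕ) (c : K) (E : M3 K) : dr p q (c • E) = c • dr p q E := by
  refine LinearMap.ext fun M => Subtype.ext ?_
  exact LinearMap.congr_fun (dl_smul c E) M.1
lemma dr_rel (p q : ℕ) (E F G : M3 K) (h : E * F - F * E = G) (M : VV K p q) :
    dr p q E (dr p q F M) = dr p q F (dr p q E M) + dr p q G M := Subtype.ext (dl_rel E F G h M.1)
lemma dr_rel0 (p q : ℕ) (E F : M3 K) (h : E * F - F * E = 0) (M : VV K p q) :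
    dr p q E (dr p q F M) = dr p q F (dr p q E M) := by
  rw [dr_rel p q E F 0 h]
  have := dr_smul p q (0 : K) (0 : M3 K)
  rw [zero_smul, zero_smul] at this
  simp [this]
lemma dr_relneg (p q : ℕ) (E F G : M3 K) (h : E * F - F * E = -G) (M : VV K p q) :
    dr p q E (dr p q F M) = dr p q F (dr p q E M) - dr p q G M := by
  rw [dr_rel p q E F _ h]
  have := dr_smul p q (-1 : K) G
  rw [neg_one_smul] at this
  rw [this]; simp [sub_eq_add_neg]

/-- diagonal generators -/
def h1 : Fin 3 → K := ![2/3, -1/3, -1/3]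
def h2 : Fin 3 → K := ![1/3, 1/3, -2/3]

lemma dr_diag (p q : ℕ) (h : Fin 3 → K) (i j : Fin 3) (M : VV K p q) :
    dr p q (Matrix.diagonal h) (dr p q (Matrix.single i j 1) M) =
      dr p q (Matrix.single i j 1) (dr p q (Matrix.diagonal h) M) + (h i - h j) • dr p q (Matrix.single i j 1) M := by
  rw [dr_rel p q _ _ ((h i - h j) • Matrix.single i j 1), dr_smul]
  · rfl
  · ext a b
    simp only [Matrix.sub_apply, Matrix.diagonal_mul, Matrix.mul_diagonal, Matrix.smul_apply, Matrix.single_apply]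
    split_ifs with hh
    · simp [hh.1, hh.2]
    · simp

lemma dr_diag_diag (p q : ℕ) (h k : Fin 3 → K) (M : VV K p q) :
    dr p q (Matrix.diagonal h) (dr p q (Matrix.diagonal k) M) =
      dr p q (Matrix.diagonal k) (dr p q (Matrix.diagonal h) M) := by
  refine dr_rel0 p q _ _ ?_ M
  simp [mul_comm]

/-- The representation on a homogeneous component. -/
def rep (K : Type*) [Field K] [CharZero K] (p q : ℕ) : GlRep K (VV K p q) where
  e1 := dr p q (Matrix.single 0 1 1)
  e2 := dr p q (Matrix.single 1 2 1)
  e3 := dr p q (Matrix.single 0 2 1)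
  f1 := dr p q (Matrix.single 1 0 1)
  f2 := dr p q (Matrix.single 2 1 1)
  f3 := dr p q (Matrix.single 2 0 1)
  H1 := dr p q (Matrix.diagonal h1)
  H2 := dr p q (Matrix.diagonal h2)
  e1f1 v := by
    rw [dr_rel p q _ _ ((2 : K) • Matrix.diagonal h1 + (-1 : K) • Matrix.diagonal h2), dr_add, dr_smul, dr_smul]
    · simp only [LinearMap.add_apply, LinearMap.smul_apply]; module
    · ext i j; fin_cases i <;> fin_cases j <;> simp [h1, h2] <;> norm_num
  e2f2 v := by
    rw [dr_rel p q _ _ ((2 : K) • Matrix.diagonal h2 + (-1 : K) • Matrix.diagonal h1), dr_add, dr_smul, dr_smul]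
    · simp only [LinearMap.add_apply, LinearMap.smul_apply]; module
    · ext i j; fin_cases i <;> fin_cases j <;> simp [h1, h2] <;> norm_num
  e3f3 v := by
    rw [dr_rel p q _ _ (Matrix.diagonal h1 + Matrix.diagonal h2), dr_add]
    · simp only [LinearMap.add_apply]; module
    · ext i j; fin_cases i <;> fin_cases j <;> simp [h1, h2] <;> norm_num
  e1f2 v := dr_rel0 p q _ _ (by simp) v
  e2f1 v := dr_rel0 p q _ _ (by simp) v
  e1f3 v := dr_relneg p q _ _ _ (by simp) v
  e2f3 v := dr_rel p q _ _ _ (by simp) v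
  e3f1 v := dr_relneg p q _ _ _ (by simp) v
  e3f2 v := dr_rel p q _ _ _ (by simp) v
  e1e2 v := dr_rel p q _ _ _ (by simp) v
  e1e3 v := dr_rel0 p q _ _ (by simp) v
  e2e3 v := dr_rel0 p q _ _ (by simp) v
  f2f1 v := dr_rel p q _ _ _ (by simp) v
  f1f3 v := dr_rel0 p q _ _ (by simp) v
  f2f3 v := dr_rel0 p q _ _ (by simp) v
  H1e1 v := by
    rw [dr_diag]
    simp [h1, h2]
    try norm_num
    try module
  H1e2 v := by
    rw [dr_diag]
    simp [h1, h2]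
    try norm_num
    try module
  H1e3 v := by
    rw [dr_diag]
    simp [h1, h2]
    try norm_num
    try module
  H2e1 v := by
    rw [dr_diag]
    simp [h1, h2]
    try norm_num
    try module
  H2e2 v := by
    rw [dr_diag]
    simp [h1, h2]
    try norm_num
    try module
  H2e3 v := by
    rw [dr_diag]
    simp [h1, h2]
    try norm_num
    try module
  H1f1 v := by
    rw [dr_diag]
    simp [h1, h2]
    try norm_num
    try module
  H1f2 v := by
    rw [dr_diag]
    simp [h1, h2]
    try norm_num
    try module
  H1f3 v := by
    rw [dr_diag]
    simp [h1, h2]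
    try norm_num
    try module
  H2f1 v := by
    rw [dr_diag]
    simp [h1, h2]
    try norm_num
    try module
  H2f2 v := by
    rw [dr_diag]
    simp [h1, h2]
    try norm_num
    try module
  H2f3 v := by
    rw [dr_diag]
    simp [h1, h2]
    try norm_num
    try module
  H1H2 v := dr_diag_diag p q _ _ v

end TR

namespace TR
variable {K : Type*} [Field K]

/-- evaluation of a matrix of polynomials -/
def ev (M : MM K) (A B : M3 K) : M3 K := M.map (MvPolynomial.eval (pairSub A B))

lemma ev_ext (M : MM K) [CharZero K] (h : ∀ A B, ev M A B = 0) : M = 0 := by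
  ext1 i j
  refine MvPolynomial.funext fun x => ?_
  have := congrFun (congrFun (h (Matrix.of fun i j => x (Sum.inl (i, j))) (Matrix.of fun i j => x (Sum.inr (i, j)))) i) j
  have hx : pairSub (Matrix.of fun i j => x (Sum.inl (i, j))) (Matrix.of fun i j => x (Sum.inr (i, j))) = x := by
    funext v; rcases v with ⟨i, j⟩ | ⟨i, j⟩ <;> rfl
  simpa [ev, hx] using this

/-- polynomial matrices in one parameter -/
abbrev M3X (K : Type*) [Field K] := Matrix (Fin 3) (Fin 3) (Polynomial K)

lemma mapd_mul (M N : M3X K) : (M * N).map Polynomial.derivative =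
    M.map Polynomial.derivative * N + M * N.map Polynomial.derivative := by
  ext1 i j
  simp only [Matrix.map_apply, Matrix.mul_apply, Matrix.add_apply, Polynomial.derivative_sum, Polynomial.derivative_mul,
    ← Finset.sum_add_distrib]

def EX (E : M3 K) : M3X K := E.map Polynomial.C
lemma mapd_EX (E : M3 K) : (EX E).map Polynomial.derivative = 0 := by ext1 i j; simp [EX]
def up (E : M3 K) : M3X K := 1 + (Polynomial.X : Polynomial K) • EX E
def dn (E : M3 K) : M3X K := 1 - (Polynomial.X : Polynomial K) • EX E
lemma mapd_up (E : M3 K) : (up E).map Polynomial.derivative = EX E := by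
  ext1 i j
  by_cases h : i = j <;> simp [up, EX, Matrix.one_apply, h]
lemma mapd_dn (E : M3 K) : (dn E).map Polynomial.derivative = -EX E := by
  ext1 i j
  by_cases h : i = j <;> simp [dn, EX, Matrix.one_apply, h]
lemma EX_sq (E : M3 K) (hE : E * E = 0) : EX E * EX E = 0 := by
  rw [EX, ← Matrix.map_mul, hE]; ext1; simp
lemma E_up (E : M3 K) (hE : E * E = 0) : EX E * up E = EX E := by
  simp [up, mul_add, EX_sq E hE]
lemma up_E (E : M3 K) (hE : E * E = 0) : up E * EX E = EX E := by
  simp [up, add_mul, EX_sq E hE]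
lemma E_dn (E : M3 K) (hE : E * E = 0) : EX E * dn E = EX E := by
  simp [dn, mul_sub, EX_sq E hE]
lemma dn_E (E : M3 K) (hE : E * E = 0) : dn E * EX E = EX E := by
  simp [dn, sub_mul, EX_sq E hE]

def ph (E A B : M3 K) : PP K →ₐ[K] Polynomial K :=
  MvPolynomial.aeval (pairSub (up E * EX A * dn E) (up E * EX B * dn E))

lemma gX_ph (E A B : M3 K) : (gX K).map (ph E A B) = up E * EX A * dn E := by
  ext1 i j; simp [gX, ph, pairSub]
lemma gY_ph (E A B : M3 K) : (gY K).map (ph E A B) = up E * EX B * dn E := by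
  ext1 i j; simp [gY, ph, pairSub]
lemma Ec_ph (E A B F : M3 K) : (Ec F).map (ph E A B) = EX F := by
  ext1 i j; simp [Ec, EX, ph]
lemma map_ph_mul (E A B : M3 K) (M N : MM K) : (M * N).map (ph E A B) = M.map (ph E A B) * N.map (ph E A B) := by
  simp [Matrix.map_mul]
lemma map_ph_sub (E A B : M3 K) (M N : MM K) : (M - N).map (ph E A B) = M.map (ph E A B) - N.map (ph E A B) := by
  ext1 i j; simp
lemma map_ph_add (E A B : M3 K) (M N : MM K) : (M + N).map (ph E A B) = M.map (ph E A B) + N.map (ph E A B) := by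
  ext1 i j; simp

lemma chain_aux (E A : M3 K) (hE : E * E = 0) : (up E * EX A * dn E).map Polynomial.derivative =
    -((up E * EX A * dn E) * EX E - EX E * (up E * EX A * dn E)) := by
  have e1 : up E * EX A * dn E * EX E = up E * EX A * EX E := by rw [mul_assoc, dn_E E hE]
  have e2 : EX E * (up E * EX A * dn E) = EX E * EX A * dn E := by
    rw [← mul_assoc, ← mul_assoc, E_up E hE]
  rw [e1, e2, mapd_mul, mapd_mul, mapd_up, mapd_dn, mapd_EX]
  noncomm_ring

lemma chain (E A B : M3 K) (hE : E * E = 0) (f : PP K) :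
    Polynomial.derivative (ph E A B f) = - ph E A B (DD E f) := by
  induction f using MvPolynomial.induction_on with
  | C a => simp [ph]
  | add p q hp hq => simp only [map_add, hp, hq]; ring
  | mul_X p v hp =>
    have hv : Polynomial.derivative (ph E A B (X v)) = - ph E A B (DD E (X v)) := by
      have h1 := chain_aux E A hE
      have h2 := chain_aux E B hE
      rw [← gX_ph E A B, ← Ec_ph E A B, ← map_ph_mul, ← map_ph_mul, ← map_ph_sub] at h1
      rw [← gY_ph E A B, ← Ec_ph E A B, ← map_ph_mul, ← map_ph_mul, ← map_ph_sub] at h2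
      rcases v with ⟨i, j⟩ | ⟨i, j⟩
      · have := congrFun (congrFun h1 i) j
        simp only [DD, mkDerivation_X]
        exact this
      · have := congrFun (congrFun h2 i) j
        simp only [DD, mkDerivation_X]
        exact this
    rw [map_mul, Polynomial.derivative_mul, hp, hv, Derivation.leibniz, map_add, smul_eq_mul, smul_eq_mul,
      map_mul, map_mul]
    ring

lemma chainM (E A B : M3 K) (hE : E * E = 0) (M : MM K) :
    (M.map (ph E A B)).map Polynomial.derivative = - (M.map (DD E)).map (ph E A B) := by
  ext1 i j; simp [chain E A B hE]

def evc (c : K) : M3X K → M3 K := fun M => M.map (Polynomial.eval c)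
lemma evc_mul (c : K) (M N : M3X K) : evc c (M * N) = evc c M * evc c N := by
  ext1 i j; simp [evc, Matrix.mul_apply, Polynomial.eval_finsetSum]
lemma evc_EX (c : K) (E : M3 K) : evc c (EX E) = E := by ext1; simp [evc, EX]
lemma evc_up (c : K) (E : M3 K) : evc c (up E) = 1 + c • E := by
  ext1 i j; by_cases h : i = j <;> (simp [evc, up, EX, Matrix.one_apply, h]; exact mul_comm _ _)
lemma evc_dn (c : K) (E : M3 K) : evc c (dn E) = 1 - c • E := by
  ext1 i j; by_cases h : i = j <;> (simp [evc, dn, EX, Matrix.one_apply, h]; exact mul_comm _ _)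

lemma evc_ph (c : K) (E A B : M3 K) (M : MM K) : evc c (M.map (ph E A B)) =
    ev M ((1 + c • E) * A * (1 - c • E)) ((1 + c • E) * B * (1 - c • E)) := by
  have hA : evc c (up E * EX A * dn E) = (1 + c • E) * A * (1 - c • E) := by
    rw [evc_mul, evc_mul, evc_up, evc_dn, evc_EX]
  have hB : evc c (up E * EX B * dn E) = (1 + c • E) * B * (1 - c • E) := by
    rw [evc_mul, evc_mul, evc_up, evc_dn, evc_EX]
  rw [← hA, ← hB]
  ext1 i j
  simp only [evc, ev, Matrix.map_apply, ph]
  generalize M i j = f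
  induction f using MvPolynomial.induction_on with
  | C a => simp
  | add p q hp hq => simp only [map_add, Polynomial.eval_add, hp, hq]
  | mul_X p v hp =>
    rw [map_mul, map_mul, Polynomial.eval_mul, hp, aeval_X, eval_X]
    rcases v with ⟨i, j⟩ | ⟨i, j⟩ <;> rfl

lemma up_eq {E : M3 K} (hE : E * E = 0) (c : K) : (1 + c • E) * (1 - c • E) = 1 := by
  have : (c • E) * (c • E) = 0 := by simp [hE]
  rw [add_mul, mul_sub, mul_sub, this]; simp
lemma dn_eq {E : M3 K} (hE : E * E = 0) (c : K) : (1 - c • E) * (1 + c • E) = 1 := by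
  have : (c • E) * (c • E) = 0 := by simp [hE]
  rw [sub_mul, mul_add, mul_add, this]; simp

lemma equi_of_dl [CharZero K] (E : M3 K) (hE : E * E = 0) (M : MM K) (h : dl E M = 0) (A B : M3 K) (c : K) :
    ev M ((1 + c • E) * A * (1 - c • E)) ((1 + c • E) * B * (1 - c • E)) =
      (1 + c • E) * ev M A B * (1 - c • E) := by
  set Q := M.map (ph E A B) with hQ
  have hd : Q.map Polynomial.derivative = EX E * Q - Q * EX E := by
    have h' : M.map (DD E) = M * Ec E - Ec E * M := by
      rw [dl_apply] at h
      rw [← sub_eq_zero, ← h]; abel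
    rw [hQ, chainM E A B hE, h', map_ph_sub, map_ph_mul, map_ph_mul, Ec_ph]; abel
  have hG : (dn E * Q * up E).map Polynomial.derivative = 0 := by
    rw [mapd_mul, mapd_mul, mapd_up, mapd_dn, hd]
    have : (-EX E * Q + dn E * (EX E * Q - Q * EX E)) * up E =
        -(EX E * Q * up E) + (dn E * EX E) * Q * up E - dn E * Q * (EX E * up E) := by noncomm_ring
    rw [this, dn_E E hE, E_up E hE]; abel
  have hc : evc c (dn E * Q * up E) = evc 0 (dn E * Q * up E) := by
    ext1 i j
    have := congrFun (congrFun hG i) j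
    simp only [Matrix.map_apply, Matrix.zero_apply] at this
    have h2 := Polynomial.eq_C_of_natDegree_eq_zero (Polynomial.derivative_eq_zero.1 this)
    simp only [evc, Matrix.map_apply]
    rw [h2]; simp
  simp only [evc_mul, evc_up, evc_dn, hQ, evc_ph, zero_smul, add_zero, sub_zero, one_mul, mul_one] at hc
  rw [← hc]
  generalize ev M ((1 + c • E) * A * (1 - c • E)) ((1 + c • E) * B * (1 - c • E)) = N
  have : (1 + c • E) * ((1 - c • E) * N * (1 + c • E)) * (1 - c • E) =
      ((1 + c • E) * (1 - c • E)) * N * ((1 + c • E) * (1 - c • E)) := by simp only [mul_assoc]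
  rw [this, up_eq hE, one_mul, mul_one]

lemma dl_of_equi [CharZero K] (E : M3 K) (hE : E * E = 0) (M : MM K)
    (h : ∀ (A B : M3 K) (c : K), ev M ((1 + c • E) * A * (1 - c • E)) ((1 + c • E) * B * (1 - c • E)) =
      (1 + c • E) * ev M A B * (1 - c • E)) : dl E M = 0 := by
  refine ev_ext _ fun A B => ?_
  have hQ : M.map (ph E A B) = up E * EX (ev M A B) * dn E := by
    ext1 i j
    refine Polynomial.funext fun c => ?_
    have : evc c (M.map (ph E A B)) = evc c (up E * EX (ev M A B) * dn E) := by
      rw [evc_ph, h, evc_mul, evc_mul, evc_up, evc_dn, evc_EX]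
    exact congrFun (congrFun this i) j
  have h1 := chainM E A B hE M
  rw [hQ, mapd_mul, mapd_mul, mapd_up, mapd_EX, mapd_dn] at h1
  have h2 := congrArg (evc 0) h1
  have e1 : evc 0 (-(M.map (DD E)).map (ph E A B)) = - ev (M.map (DD E)) A B := by
    have := evc_ph 0 E A B (M.map (DD E))
    simp only [zero_smul, add_zero, sub_zero, one_mul, mul_one] at this
    rw [← this]
    ext1 i j; simp [evc]
  have e2 : evc 0 ((EX E * EX (ev M A B) + up E * 0) * dn E + up E * EX (ev M A B) * -EX E) =
      E * ev M A B - ev M A B * E := by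
    have : (EX E * EX (ev M A B) + up E * 0) * dn E + up E * EX (ev M A B) * -EX E
      = EX E * EX (ev M A B) * dn E - up E * EX (ev M A B) * EX E := by noncomm_ring
    rw [this]
    have hs : ∀ P Q : M3X K, evc 0 (P - Q) = evc 0 P - evc 0 Q := by
      intro P Q; ext1 i j; simp [evc]
    rw [hs]
    simp [evc_mul, evc_EX, evc_up, evc_dn]
  rw [e1, e2] at h2
  have e3 : ev (dl E M) A B = ev (M.map (DD E)) A B + (E * ev M A B - ev M A B * E) := by
    rw [dl_apply]
    have hE' : ev (Ec E) A B = E := by ext1 i j; simp [ev, Ec]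
    have hm : ∀ P Q : MM K, ev (P * Q) A B = ev P A B * ev Q A B := by
      intro P Q; simp [ev, Matrix.map_mul]
    have hs : ∀ P Q : MM K, ev (P - Q) A B = ev P A B - ev Q A B := by
      intro P Q; ext1 i j; simp [ev]
    have ha : ∀ P Q : MM K, ev (P + Q) A B = ev P A B + ev Q A B := by
      intro P Q; ext1 i j; simp [ev]
    rw [ha, hs, hm, hm, hE']
  rw [e3, h2]; abel

end TR

namespace TR
variable {K : Type*} [Field K]

/-- integral weights of the standard representation -/
def om : Fin 3 → ℤ × ℤ := ![(1, 1), (0, 1), (0, 0)]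
/-- weight of a pair of indices -/
def rt (ij : Fin 3 × Fin 3) : ℤ × ℤ := om ij.1 - om ij.2
/-- weight of a variable -/
def rtv : MatVar 3 → ℤ × ℤ
  | Sum.inl ij => rt ij
  | Sum.inr ij => rt ij

lemma h1_om [CharZero K] (i j : Fin 3) : (h1 i - h1 j : K) = (((om i - om j).1 : ℤ) : K) := by
  fin_cases i <;> fin_cases j <;> simp [h1, om] <;> norm_num
lemma h2_om [CharZero K] (i j : Fin 3) : (h2 i - h2 j : K) = (((om i - om j).2 : ℤ) : K) := by
  fin_cases i <;> fin_cases j <;> simp [h2, om] <;> norm_num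

lemma w1 [CharZero K] (d : MatVar 3 →₀ ℕ) :
    Finsupp.weight (rtK (h1 : Fin 3 → K)) d = (((Finsupp.weight rtv d).1 : ℤ) : K) := by
  have : ∀ v, rtK (h1 : Fin 3 → K) v = (((rtv v).1 : ℤ) : K) := by
    rintro (⟨i, j⟩ | ⟨i, j⟩) <;> exact h1_om i j
  simp only [Finsupp.weight_apply, Finsupp.sum, this, Prod.fst_sum, Prod.smul_fst]
  push_cast
  simp
lemma w2 [CharZero K] (d : MatVar 3 →₀ ℕ) :
    Finsupp.weight (rtK (h2 : Fin 3 → K)) d = (((Finsupp.weight rtv d).2 : ℤ) : K) := by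
  have : ∀ v, rtK (h2 : Fin 3 → K) v = (((rtv v).2 : ℤ) : K) := by
    rintro (⟨i, j⟩ | ⟨i, j⟩) <;> exact h2_om i j
  simp only [Finsupp.weight_apply, Finsupp.sum, this, Prod.snd_sum, Prod.smul_snd]
  push_cast
  simp

/-- weight of a matrix monomial -/
def mu (i j : Fin 3) (d : MatVar 3 →₀ ℕ) : ℤ × ℤ := om i - om j - Finsupp.weight rtv d

lemma coeff_h1 [CharZero K] (d : MatVar 3 →₀ ℕ) (M : MM K) (i j : Fin 3) :
    coeff d (dl (Matrix.diagonal h1) M i j) = (((mu i j d).1 : ℤ) : K) * coeff d (M i j) := by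
  rw [coeff_dl_diag, h1_om, w1, mu]; simp
lemma coeff_h2 [CharZero K] (d : MatVar 3 →₀ ℕ) (M : MM K) (i j : Fin 3) :
    coeff d (dl (Matrix.diagonal h2) M i j) = (((mu i j d).2 : ℤ) : K) * coeff d (M i j) := by
  rw [coeff_dl_diag, h2_om, w2, mu]; simp

lemma wt_iff [CharZero K] (M : MM K) (m n : ℤ) :
    (dl (Matrix.diagonal h1) M = (m : K) • M ∧ dl (Matrix.diagonal h2) M = (n : K) • M) ↔
      ∀ i j d, coeff d (M i j) ≠ 0 → mu i j d = (m, n) := by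
  constructor
  · rintro ⟨ha, hb⟩ i j d hd
    have ha' := congrArg (coeff d) (congrFun (congrFun ha i) j)
    have hb' := congrArg (coeff d) (congrFun (congrFun hb i) j)
    rw [coeff_h1, Matrix.smul_apply, coeff_smul, smul_eq_mul] at ha'
    rw [coeff_h2, Matrix.smul_apply, coeff_smul, smul_eq_mul] at hb'
    exact Prod.ext (by exact_mod_cast mul_right_cancel₀ hd ha') (by exact_mod_cast mul_right_cancel₀ hd hb')
  · intro h
    constructor
    · ext i j d
      rw [coeff_h1, Matrix.smul_apply, coeff_smul, smul_eq_mul]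
      by_cases hd : coeff d (M i j) = 0
      · simp [hd]
      · rw [h i j d hd]
    · ext i j d
      rw [coeff_h2, Matrix.smul_apply, coeff_smul, smul_eq_mul]
      by_cases hd : coeff d (M i j) = 0
      · simp [hd]
      · rw [h i j d hd]

lemma torus [CharZero K] (M : MM K) (h : ∀ i j d, coeff d (M i j) ≠ 0 → mu i j d = 0)
    (D : Fin 3 → K) (hD : ∀ i, D i ≠ 0) (A B : M3 K) :
    ev M (Matrix.diagonal D * A * Matrix.diagonal (fun i => (D i)⁻¹))
      (Matrix.diagonal D * B * Matrix.diagonal (fun i => (D i)⁻¹)) =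
    Matrix.diagonal D * ev M A B * Matrix.diagonal (fun i => (D i)⁻¹) := by
  set ch : ℤ × ℤ → K := fun m => (D 0 / D 1) ^ m.1 * (D 1 / D 2) ^ m.2 with hch
  have h01 : D 0 / D 1 ≠ 0 := div_ne_zero (hD _) (hD _)
  have h12 : D 1 / D 2 ≠ 0 := div_ne_zero (hD _) (hD _)
  have hadd : ∀ m n, ch (m + n) = ch m * ch n := by
    intro m n; simp only [hch, Prod.fst_add, Prod.snd_add, zpow_add₀ h01, zpow_add₀ h12]; ring
  have hns : ∀ (k : ℕ) m, ch (k • m) = ch m ^ k := by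
    intro k m
    induction k with
    | zero => simp [hch]
    | succ k ih => rw [succ_nsmul, hadd, ih, pow_succ]
  have hsum : ∀ (s : Finset (MatVar 3)) (g : MatVar 3 → ℤ × ℤ), ch (∑ v ∈ s, g v) = ∏ v ∈ s, ch (g v) := by
    intro s g
    induction s using Finset.induction_on with
    | empty => simp [hch]
    | insert a s ha ih => rw [Finset.sum_insert ha, Finset.prod_insert ha, hadd, ih]
  have hij : ∀ i j, ch (om i - om j) = D i * (D j)⁻¹ := by
    intro i j
    have := hD 0; have := hD 1; have := hD 2
    fin_cases i <;> fin_cases j <;> simp [hch, om] <;> field_simp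
  have hsub : pairSub (Matrix.diagonal D * A * Matrix.diagonal (fun i => (D i)⁻¹))
      (Matrix.diagonal D * B * Matrix.diagonal (fun i => (D i)⁻¹)) = fun v => ch (rtv v) * pairSub A B v := by
    funext v
    rcases v with ⟨i, j⟩ | ⟨i, j⟩ <;>
    · simp only [pairSub, rtv, rt, hij, Matrix.mul_diagonal, Matrix.diagonal_mul]
      ring
  ext1 i j
  rw [Matrix.mul_diagonal, Matrix.diagonal_mul, ev, ev, Matrix.map_apply, Matrix.map_apply, hsub,
    MvPolynomial.eval_eq, MvPolynomial.eval_eq, Finset.mul_sum, Finset.sum_mul]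
  refine Finset.sum_congr rfl fun d hd => ?_
  have hd' := h i j d (by simpa using hd)
  rw [mu, sub_eq_zero] at hd'
  have : ∏ v ∈ d.support, ch (rtv v) ^ d v = D i * (D j)⁻¹ := by
    rw [← hij, hd', Finsupp.weight_apply, Finsupp.sum, hsum]
    exact Finset.prod_congr rfl fun v _ => (hns _ _).symm
  simp only [mul_pow, Finset.prod_mul_distrib, this]
  ring

def EqAt (M : MM K) (a : M3 K) : Prop := ∀ A B : M3 K, ev M (a * A * a⁻¹) (a * B * a⁻¹) = a * ev M A B * a⁻¹

lemma equi_iff (M : MM K) : IsMatEquivariant M ↔ ∀ a : M3 K, a.det ≠ 0 → EqAt M a := by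
  constructor
  · intro h a ha A B
    have := h (Matrix.GeneralLinearGroup.mkOfDetNeZero a ha) A B
    rw [Matrix.coe_units_inv] at this
    exact this
  · intro h a A B
    rw [Matrix.coe_units_inv]
    exact h a (Matrix.GeneralLinearGroup.det_ne_zero a) A B

lemma EqAt_mul (M : MM K) (a b : M3 K) (ha : EqAt M a) (hb : EqAt M b) : EqAt M (a * b) := by
  intro A B
  have e : ∀ N : M3 K, a * b * N * (a * b)⁻¹ = a * (b * N * b⁻¹) * a⁻¹ := by
    intro N; rw [Matrix.mul_inv_rev]; simp only [mul_assoc]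
  rw [e, e, e, ha, hb]

lemma single_sq (i j : Fin 3) (h : i ≠ j) : (Matrix.single i j 1 : M3 K) * Matrix.single i j 1 = 0 := by
  simp [h.symm]

lemma transv_inv {E : M3 K} (hE : E * E = 0) (c : K) : (1 + c • E)⁻¹ = 1 - c • E :=
  Matrix.inv_eq_right_inv (up_eq hE c)

theorem equi_dl [CharZero K] (M : MM K) :
    IsMatEquivariant M ↔ ∀ i j, i ≠ j → dl (Matrix.single i j 1) M = 0 := by
  rw [equi_iff]
  constructor
  · intro h i j hij
    have hE := single_sq (K := K) i j hij
    refine dl_of_equi _ hE M fun A B c => ?_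
    have hdet : (1 + c • (Matrix.single i j 1 : M3 K)).det ≠ 0 := by
      have h1 := congrArg Matrix.det (up_eq hE c)
      rw [Matrix.det_mul, Matrix.det_one] at h1
      exact left_ne_zero_of_mul_eq_one h1
    have := h _ hdet A B
    rwa [transv_inv hE] at this
  · intro h a ha
    refine Matrix.diagonal_transvection_induction_of_det_ne_zero (EqAt M) a ha ?_ ?_ ?_
    · intro D hD A B
      rw [Matrix.det_diagonal, Finset.prod_ne_zero_iff] at hD
      have hinv : (Matrix.diagonal D : M3 K)⁻¹ = Matrix.diagonal (fun i => (D i)⁻¹) := by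
        refine Matrix.inv_eq_right_inv ?_
        rw [Matrix.diagonal_mul_diagonal, ← Matrix.diagonal_one]
        congr 1; funext i; exact mul_inv_cancel₀ (hD i (Finset.mem_univ i))
      rw [hinv]
      refine torus M ?_ D (fun i => hD i (Finset.mem_univ i)) A B
      have key : ∀ i j : Fin 3, i ≠ j → dl (Matrix.diagonal (Pi.single i 1 - Pi.single j 1)) M = 0 := by
        intro i j hij
        have e := dl_bracket (Matrix.single i j 1) (Matrix.single j i 1) M
        rw [h i j hij, h j i hij.symm, map_zero, map_zero, zero_add] at e
        rw [e]; congr 2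
        ext a b
        fin_cases i <;> fin_cases j <;> fin_cases a <;> fin_cases b <;> simp at hij ⊢
      have k1 := key 0 1 (by decide)
      have k2 := key 1 2 (by decide)
      refine (wt_iff M 0 0).1 ⟨?_, ?_⟩
      · have : (Matrix.diagonal h1 : M3 K) = (2/3 : K) • Matrix.diagonal (Pi.single 0 1 - Pi.single 1 1)
            + (1/3 : K) • Matrix.diagonal (Pi.single 1 1 - Pi.single 2 1) := by
          ext a b
          fin_cases a <;> fin_cases b <;> simp [h1] <;> norm_num
        rw [this, dl_add, dl_smul, dl_smul, LinearMap.add_apply, LinearMap.smul_apply, LinearMap.smul_apply, k1, k2]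
        simp
      · have : (Matrix.diagonal h2 : M3 K) = (1/3 : K) • Matrix.diagonal (Pi.single 0 1 - Pi.single 1 1)
            + (2/3 : K) • Matrix.diagonal (Pi.single 1 1 - Pi.single 2 1) := by
          ext a b
          fin_cases a <;> fin_cases b <;> simp [h2] <;> norm_num
        rw [this, dl_add, dl_smul, dl_smul, LinearMap.add_apply, LinearMap.smul_apply, LinearMap.smul_apply, k1, k2]
        simp
    · intro t A B
      have ht : t.toMatrix = 1 + t.c • (Matrix.single t.i t.j 1 : M3 K) := by
        rw [Matrix.TransvectionStruct.toMatrix, Matrix.transvection]; simp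
      have hE := single_sq (K := K) t.i t.j t.hij
      rw [ht, transv_inv hE]
      exact equi_of_dl _ hE M (h _ _ t.hij) A B t.c
    · intro A B _ _ hA hB
      exact EqAt_mul M A B hA hB

theorem mixedDim_eq_inv [CharZero K] (p q : ℕ) :
    mixedDim K 3 p q = Module.finrank K (rep K p q).inv := by
  have hset : mixedComponent K 3 p q = (((rep K p q).inv.map (VV K p q).subtype : Submodule K (MM K)) : Set (MM K)) := by
    ext M
    constructor
    · rintro ⟨hM, hh⟩
      rw [equi_dl] at hM
      refine ⟨⟨M, hh⟩, ?_, rfl⟩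
      exact ⟨Subtype.ext (hM 0 1 (by decide)), Subtype.ext (hM 1 2 (by decide)), Subtype.ext (hM 0 2 (by decide)),
        Subtype.ext (hM 1 0 (by decide)), Subtype.ext (hM 2 1 (by decide)), Subtype.ext (hM 2 0 (by decide))⟩
    · rintro ⟨⟨M', hM'⟩, ⟨a1, a2, a3, a4, a5, a6⟩, rfl⟩
      refine ⟨(equi_dl _).2 ?_, hM'⟩
      intro i j hij
      fin_cases i <;> fin_cases j
      · exact absurd rfl hij
      · exact congrArg Subtype.val a1
      · exact congrArg Subtype.val a3
      · exact congrArg Subtype.val a4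
      · exact absurd rfl hij
      · exact congrArg Subtype.val a2
      · exact congrArg Subtype.val a6
      · exact congrArg Subtype.val a5
      · exact absurd rfl hij
  rw [mixedDim, hset, Set.finrank, Submodule.span_eq]
  exact (Submodule.equivMapOfInjective _ (VV K p q).injective_subtype _).finrank_eq.symm

end TR

namespace TR
variable {K : Type*} [Field K]

/-- exponents of bidegree `(p, q)` -/
lemma fin_bideg (p q : ℕ) : {d : MatVar 3 →₀ ℕ | Finsupp.weight (bideg 3) d = (p, q)}.Finite := by
  refine (Finsupp.finite_of_degree_le (p + q)).subset fun d hd => ?_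
  have h : Finsupp.weight (bideg 3) d = (p, q) := hd
  have h1 : ∀ v, (bideg 3 v).1 + (bideg 3 v).2 = 1 := by rintro (v | v) <;> rfl
  have : Finsupp.degree d = p + q := by
    rw [Finsupp.weight_apply, Finsupp.sum, Prod.ext_iff] at h
    simp only [Prod.fst_sum, Prod.snd_sum, Prod.smul_fst, Prod.smul_snd] at h
    rw [← h.1, ← h.2, ← Finset.sum_add_distrib, Finsupp.degree_apply]
    refine Finset.sum_congr rfl fun v _ => ?_
    rw [smul_eq_mul, smul_eq_mul, ← mul_add, h1, mul_one]
  exact this.le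

def DS (p q : ℕ) : Finset (MatVar 3 →₀ ℕ) := (fin_bideg p q).toFinset
lemma mem_DS {p q : ℕ} {d : MatVar 3 →₀ ℕ} : d ∈ DS p q ↔ Finsupp.weight (bideg 3) d = (p, q) := by
  simp [DS]

abbrev Idx := Fin 3 × Fin 3 × (MatVar 3 →₀ ℕ)

def SP (K : Type*) [Field K] (S : Finset Idx) : Submodule K (MM K) where
  carrier := {M | ∀ x : Idx, x ∉ S → coeff x.2.2 (M x.1 x.2.1) = 0}
  add_mem' := fun ha hb x hx => by simp [ha x hx, hb x hx]
  zero_mem' := fun x hx => by simp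
  smul_mem' := fun c _ ha x hx => by simp [ha x hx]

def SPmap (K : Type*) [Field K] (S : Finset Idx) : SP K S →ₗ[K] (S → K) where
  toFun M := fun x => coeff x.1.2.2 (M.1 x.1.1 x.1.2.1)
  map_add' M N := by funext x; simp
  map_smul' c M := by funext x; simp

lemma SPmap_bij (S : Finset Idx) : Function.Bijective (SPmap K S) := by
  classical
  constructor
  · rw [← LinearMap.ker_eq_bot, LinearMap.ker_eq_bot']
    rintro ⟨M, hM⟩ h
    refine Subtype.ext ?_
    ext i j d
    by_cases hx : (i, j, d) ∈ S
    · exact congrFun h ⟨_, hx⟩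
    · exact hM (i, j, d) hx
  · intro g
    have hc : ∀ i j d, coeff d (∑ x ∈ S.attach, if x.1.1 = i ∧ x.1.2.1 = j then monomial x.1.2.2 (g x) else 0) =
        if h : (i, j, d) ∈ S then g ⟨_, h⟩ else 0 := by
      intro i j d
      rw [coeff_sum]
      have : ∀ x ∈ S.attach, coeff d (if x.1.1 = i ∧ x.1.2.1 = j then monomial x.1.2.2 (g x) else 0) =
          if x.1 = (i, j, d) then g x else 0 := by
        rintro ⟨⟨a, b, c⟩, hx⟩ _
        by_cases h1 : a = i <;> by_cases h2 : b = j <;> by_cases h3 : c = d <;> simp [h1, h2, h3]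
      rw [Finset.sum_congr rfl this]
      split_ifs with h
      · rw [Finset.sum_eq_single ⟨_, h⟩]
        · simp
        · intro b _ hb
          rw [if_neg]; intro hh; exact hb (Subtype.ext hh)
        · intro hh; exact absurd (Finset.mem_attach _ _) hh
      · refine Finset.sum_eq_zero fun x _ => ?_
        rw [if_neg]; intro hh; exact h (hh ▸ x.2)
    refine ⟨⟨fun i j => ∑ x ∈ S.attach, if x.1.1 = i ∧ x.1.2.1 = j then monomial x.1.2.2 (g x) else 0, ?_⟩, ?_⟩
    · intro x hx
      refine (hc x.1 x.2.1 x.2.2).trans ?_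
      rw [dif_neg hx]
    · funext x
      refine (hc x.1.1 x.1.2.1 x.1.2.2).trans ?_
      rw [dif_pos x.2]

lemma finrank_SP (S : Finset Idx) : Module.finrank K (SP K S) = S.card := by
  rw [(LinearEquiv.ofBijective (SPmap K S) (SPmap_bij S)).finrank_eq]
  simp

instance fd_SP (S : Finset Idx) : FiniteDimensional K (SP K S) :=
  Module.Finite.equiv (LinearEquiv.ofBijective (SPmap K S) (SPmap_bij S)).symm

def allIdx (p q : ℕ) : Finset Idx := Finset.univ ×ˢ Finset.univ ×ˢ DS p q
lemma mem_allIdx {p q : ℕ} {x : Idx} : x ∈ allIdx p q ↔ Finsupp.weight (bideg 3) x.2.2 = (p, q) := by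
  simp [allIdx, mem_DS]
def cnt (p q : ℕ) (m n : ℤ) : ℕ := ((allIdx p q).filter fun x => mu x.1 x.2.1 x.2.2 = (m, n)).card

lemma VV_eq (p q : ℕ) : VV K p q = SP K (allIdx p q) := by
  ext M
  constructor
  · intro h x hx
    by_contra hc
    exact hx (mem_allIdx.2 (h _ _ hc))
  · intro h i j d hd
    by_contra hc
    exact hd (h (i, j, d) (fun hh => hc (mem_allIdx.1 hh)))

instance fd_VV (p q : ℕ) : FiniteDimensional K (VV K p q) := by
  rw [VV_eq]; infer_instance

lemma finrank_wt [CharZero K] (p q : ℕ) (m n : ℤ) : Module.finrank K ((rep K p q).wt m n) = cnt p q m n := by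
  classical
  have hset : ((rep K p q).wt m n).map (VV K p q).subtype =
      SP K ((allIdx p q).filter fun x => mu x.1 x.2.1 x.2.2 = (m, n)) := by
    ext M
    constructor
    · rintro ⟨⟨M', hM'⟩, ⟨a1, a2⟩, rfl⟩ x hx
      have hw := (wt_iff M' m n).1 ⟨congrArg Subtype.val a1, congrArg Subtype.val a2⟩
      by_contra hc
      exact hx (Finset.mem_filter.2 ⟨mem_allIdx.2 (hM' _ _ hc), hw _ _ _ hc⟩)
    · intro h
      have hh : M ∈ VV K p q := by
        rw [VV_eq]
        intro x hx
        exact h x (fun h' => hx (Finset.mem_filter.1 h').1)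
      have hw := (wt_iff M m n).2 (fun i j d hd => by
        by_contra hc
        exact hd (h (i, j, d) (fun h' => hc (Finset.mem_filter.1 h').2)))
      exact ⟨⟨M, hh⟩, ⟨Subtype.ext hw.1, Subtype.ext hw.2⟩, rfl⟩
  rw [(Submodule.equivMapOfInjective _ (VV K p q).injective_subtype _).finrank_eq, hset, finrank_SP, cnt]

theorem mixedDim_eq [CharZero K] (p q : ℕ) :
    (mixedDim K 3 p q : ℤ) = cnt p q 0 0 - cnt p q 1 0 - cnt p q 0 1 + cnt p q 2 1 + cnt p q 1 2 - cnt p q 2 2 := by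
  rw [mixedDim_eq_inv, GlRep.finrank_inv]
  simp only [finrank_wt]

end TR

namespace TR

/-- Laurent polynomials in two variables -/
abbrev LA := AddMonoidAlgebra ℚ (ℤ × ℤ)
/-- power series in `s, t` over Laurent polynomials -/
abbrev BB := MvPowerSeries (Fin 2) LA

def zz (g : ℤ × ℤ) : LA := AddMonoidAlgebra.single g 1
lemma zz_mul (g h : ℤ × ℤ) : zz g * zz h = zz (g + h) := by
  simp [zz, AddMonoidAlgebra.single_mul_single]
lemma zz_zero : zz 0 = 1 := rfl

def sdw : MatVar 3 → (Fin 2 →₀ ℕ)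
  | Sum.inl _ => Finsupp.single 0 1
  | Sum.inr _ => Finsupp.single 1 1

lemma sdw_iff (d : MatVar 3 →₀ ℕ) (e : Fin 2 →₀ ℕ) :
    Finsupp.weight (bideg 3) d = (e 0, e 1) ↔ Finsupp.weight sdw d = e := by
  have h0 : (Finsupp.weight sdw d) 0 = (Finsupp.weight (bideg 3) d).1 := by
    simp only [Finsupp.weight_apply, Finsupp.sum, Finsupp.finsetSum_apply, Prod.fst_sum]
    refine Finset.sum_congr rfl ?_
    rintro (v | v) _ <;> simp [sdw, bideg]
  have h1 : (Finsupp.weight sdw d) 1 = (Finsupp.weight (bideg 3) d).2 := by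
    simp only [Finsupp.weight_apply, Finsupp.sum, Finsupp.finsetSum_apply, Prod.snd_sum]
    refine Finset.sum_congr rfl ?_
    rintro (v | v) _ <;> simp [sdw, bideg]
  constructor
  · intro h
    ext i; fin_cases i
    · exact h0.trans (by rw [h]; rfl)
    · exact h1.trans (by rw [h]; rfl)
  · intro h
    exact Prod.ext (by rw [← h0, h]) (by rw [← h1, h])

def TS (S : Finset (MatVar 3)) (e : Fin 2 →₀ ℕ) : Finset (MatVar 3 →₀ ℕ) :=
  (DS (e 0) (e 1)).filter fun d => d.support ⊆ S

lemma mem_TS {S : Finset (MatVar 3)} {e : Fin 2 →₀ ℕ} {d : MatVar 3 →₀ ℕ} :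
    d ∈ TS S e ↔ Finsupp.weight sdw d = e ∧ d.support ⊆ S := by
  rw [TS, Finset.mem_filter, mem_DS, sdw_iff]

def OmS (S : Finset (MatVar 3)) : BB := fun e => ∑ d ∈ TS S e, zz (Finsupp.weight rtv d)

def xv (v : MatVar 3) : BB := MvPowerSeries.monomial (sdw v) (zz (rtv v))

lemma coeff_OmS (S : Finset (MatVar 3)) (e : Fin 2 →₀ ℕ) :
    MvPowerSeries.coeff e (OmS S) = ∑ d ∈ TS S e, zz (Finsupp.weight rtv d) := rfl

lemma OmS_empty : OmS ∅ = 1 := by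
  classical
  ext1 e
  rw [coeff_OmS, MvPowerSeries.coeff_one]
  split_ifs with h
  · have : TS ∅ e = {0} := by
      ext d; rw [mem_TS]; simp [h]
      rintro rfl; simp
    rw [this]; simp [zz_zero]
  · have : TS ∅ e = ∅ := by
      ext d; rw [mem_TS]; simp
      intro h1 h2; subst h2; simp at h1; exact h h1.symm
    rw [this]; simp

lemma OmS_insert (v : MatVar 3) (S : Finset (MatVar 3)) (hv : v ∉ S) :
    OmS (insert v S) = OmS S + xv v * OmS (insert v S) := by
  classical
  ext1 e
  rw [map_add, xv, MvPowerSeries.coeff_monomial_mul, coeff_OmS, coeff_OmS]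
  rw [← Finset.sum_filter_add_sum_filter_not (TS (insert v S) e) (fun d => d v = 0)]
  congr 1
  · refine Finset.sum_congr ?_ fun _ _ => rfl
    ext d
    rw [Finset.mem_filter, mem_TS, mem_TS]
    constructor
    · rintro ⟨⟨h1, h2⟩, h3⟩
      refine ⟨h1, fun u hu => ?_⟩
      rcases Finset.mem_insert.1 (h2 hu) with h | h
      · subst h; exact absurd h3 (Finsupp.mem_support_iff.1 hu)
      · exact h
    · rintro ⟨h1, h2⟩
      refine ⟨⟨h1, h2.trans (Finset.subset_insert _ _)⟩, ?_⟩
      by_contra h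
      exact hv (h2 (Finsupp.mem_support_iff.2 h))
  · split_ifs with hle
    · rw [coeff_OmS, Finset.mul_sum]
      symm
      refine Finset.sum_bij (fun d _ => Finsupp.single v 1 + d) ?_ ?_ ?_ ?_
      · intro d hd
        rw [mem_TS] at hd
        rw [Finset.mem_filter, mem_TS, map_add, hd.1, Finsupp.weight_single, one_smul, add_tsub_cancel_of_le hle]
        refine ⟨⟨rfl, ?_⟩, by simp⟩
        refine Finsupp.support_add.trans (Finset.union_subset ?_ hd.2)
        refine Finsupp.support_single_subset.trans ?_
        simp
      · intro d _ d' _ h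
        exact add_left_cancel h
      · intro d hd
        rw [Finset.mem_filter, mem_TS] at hd
        obtain ⟨⟨h1, h2⟩, h3⟩ := hd
        have hs : Finsupp.single v 1 ≤ d := by
          rw [Finsupp.single_le_iff]; omega
        refine ⟨d - Finsupp.single v 1, ?_, add_tsub_cancel_of_le hs⟩
        rw [mem_TS]
        constructor
        · rw [← h1]
          conv_rhs => rw [← add_tsub_cancel_of_le hs, map_add, Finsupp.weight_single, one_smul]
          rw [add_tsub_cancel_left]
        · exact (Finsupp.support_mono (tsub_le_self)).trans h2
      · intro d _
        rw [zz_mul, map_add, Finsupp.weight_single, one_smul]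
    · refine Finset.sum_eq_zero fun d hd => ?_
      exfalso
      rw [Finset.mem_filter, mem_TS] at hd
      obtain ⟨⟨h1, h2⟩, h3⟩ := hd
      have hs : Finsupp.single v 1 ≤ d := by
        rw [Finsupp.single_le_iff]; omega
      apply hle
      rw [← h1, ← add_tsub_cancel_of_le hs, map_add, Finsupp.weight_single, one_smul]
      exact le_self_add

lemma OmS_prod (S : Finset (MatVar 3)) : OmS S * ∏ v ∈ S, (1 - xv v) = 1 := by
  classical
  induction S using Finset.induction_on with
  | empty => simp [OmS_empty]
  | insert v S hv ih =>
    have h := OmS_insert v S hv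
    rw [Finset.prod_insert hv]
    linear_combination (∏ v ∈ S, (1 - xv v)) * h + ih

def Om : BB := OmS Finset.univ
lemma Om_prod : Om * ∏ v, (1 - xv v) = 1 := OmS_prod _
lemma coeff_Om (e : Fin 2 →₀ ℕ) :
    MvPowerSeries.coeff e Om = ∑ d ∈ DS (e 0) (e 1), zz (Finsupp.weight rtv d) := by
  rw [Om, coeff_OmS, TS]
  congr 1
  ext d; simp

/-- constant term -/
def CT : BB →+ MvPowerSeries (Fin 2) ℚ where
  toFun f := fun e => (MvPowerSeries.coeff e f).coeff 0
  map_zero' := by ext e; simp; rfl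
  map_add' f g := by
    ext e
    change (MvPowerSeries.coeff e (f + g)).coeff 0 = (MvPowerSeries.coeff e f).coeff 0 + (MvPowerSeries.coeff e g).coeff 0
    simp
lemma coeff_CT (f : BB) (e : Fin 2 →₀ ℕ) : MvPowerSeries.coeff e (CT f) = (MvPowerSeries.coeff e f).coeff 0 := rfl

def Zc (g : ℤ × ℤ) : BB := MvPowerSeries.C (zz g)

lemma CT_Zc_Om (g : ℤ × ℤ) (e : Fin 2 →₀ ℕ) : MvPowerSeries.coeff e (CT (Zc g * Om)) =
    (((DS (e 0) (e 1)).filter fun d => Finsupp.weight rtv d = -g).card : ℚ) := by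
  classical
  rw [coeff_CT, Zc, MvPowerSeries.coeff_C_mul, coeff_Om, Finset.mul_sum, AddMonoidAlgebra.coeff_sum, Finsupp.finsetSum_apply,
    Finset.card_filter]
  push_cast
  refine Finset.sum_congr rfl fun d _ => ?_
  rw [zz_mul, zz, AddMonoidAlgebra.coeff_single, Finsupp.single_apply]
  congr 1
  rw [eq_iff_iff]
  constructor <;> intro h
  · rw [← sub_eq_zero, sub_neg_eq_add, add_comm]; exact h
  · rw [h]; simp

def chi : BB := ∑ ij : Fin 3 × Fin 3, Zc (-(om ij.1 - om ij.2))

lemma Zc_mul (g h : ℤ × ℤ) : Zc g * Zc h = Zc (g + h) := by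
  rw [Zc, Zc, ← map_mul, zz_mul]; rfl

lemma CT_chi (m n : ℤ) (e : Fin 2 →₀ ℕ) : MvPowerSeries.coeff e (CT (Zc (m, n) * chi * Om)) =
    (cnt (e 0) (e 1) m n : ℚ) := by
  classical
  rw [chi, Finset.mul_sum, Finset.sum_mul, map_sum, map_sum, cnt, Finset.card_filter, allIdx, ← Finset.univ_product_univ,
    Finset.sum_product, Finset.sum_product]
  push_cast
  refine Finset.sum_congr rfl fun i _ => ?_
  rw [Finset.sum_product]
  refine Finset.sum_congr rfl fun j _ => ?_
  rw [Zc_mul, CT_Zc_Om, Finset.card_filter]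
  push_cast
  refine Finset.sum_congr rfl fun d _ => ?_
  congr 1
  rw [eq_iff_iff, mu]
  constructor <;> intro h
  · rw [h]; abel
  · rw [← h]; abel

def Udef : BB := Zc (0,0) - Zc (1,0) - Zc (0,1) + Zc (2,1) + Zc (1,2) - Zc (2,2)

theorem mixedPS2_eq (K : Type*) [Field K] [CharZero K] : mixedPS2 K 3 = CT (Udef * chi * Om) := by
  have hU : Udef * chi * Om = Zc (0,0) * chi * Om - Zc (1,0) * chi * Om - Zc (0,1) * chi * Om + Zc (2,1) * chi * Om
     + Zc (1,2) * chi * Om - Zc (2,2) * chi * Om := by rw [Udef]; ring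
  ext e
  rw [hU]
  simp only [map_add, map_sub, CT_chi]
  change (mixedDim K 3 (e 0) (e 1) : ℚ) = _
  have := mixedDim_eq (K := K) (e 0) (e 1)
  exact_mod_cast congrArg (Int.cast : ℤ → ℚ) this

end TR

namespace TR

def vs : BB := MvPowerSeries.X 0
def vt : BB := MvPowerSeries.X 1
def va : BB := Zc (1, 0)
def vb : BB := Zc (0, 1)
def wa : BB := Zc (-1, 0)
def wb : BB := Zc (0, -1)

lemma Zc_a : Zc (1, 0) = va := rfl
lemma Zc_b : Zc (0, 1) = vb := rfl
lemma Zc_a' : Zc (-1, 0) = wa := rfl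
lemma Zc_b' : Zc (0, -1) = wb := rfl
lemma Zc_zero : Zc 0 = 1 := by rw [Zc, zz_zero, map_one]
lemma Zc_ab : Zc (1, 1) = va * vb := by rw [va, vb, Zc_mul]; rfl
lemma Zc_ab' : Zc (-1, -1) = wa * wb := by rw [wa, wb, Zc_mul]; rfl
lemma ha : va * wa = 1 := by rw [va, wa, Zc_mul, ← Zc_zero]; rfl
lemma hb : vb * wb = 1 := by rw [vb, wb, Zc_mul, ← Zc_zero]; rfl

lemma Udef_eq : Udef = (1 - va) * (1 - vb) * (1 - va * vb) := by
  have h1 : Zc (2, 1) = va * va * vb := by rw [va, vb, Zc_mul, Zc_mul]; rfl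
  have h2 : Zc (1, 2) = va * vb * vb := by rw [va, vb, Zc_mul, Zc_mul]; rfl
  have h3 : Zc (2, 2) = va * va * (vb * vb) := by rw [va, vb, Zc_mul, Zc_mul, Zc_mul]; rfl
  have h0 : Zc (0, 0) = 1 := Zc_zero
  rw [Udef, h0, h1, h2, h3, ← va, ← vb]; ring

lemma chi_eq : chi = 3 + va + vb + va * vb + wa + wb + wa * wb := by
  rw [chi, Fintype.sum_prod_type]
  simp only [Fin.sum_univ_three]
  have h0 : Zc (0, 0) = 1 := Zc_zero
  simp only [om, Matrix.cons_val_zero, Matrix.cons_val_one, Matrix.cons_val]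
  norm_num
  simp only [Zc_a, Zc_b, Zc_a', Zc_b', Zc_ab, Zc_ab', Zc_zero]
  ring

lemma xv_inl (ij : Fin 3 × Fin 3) : xv (Sum.inl ij) = vs * Zc (rt ij) := by
  rw [xv, vs, Zc, MvPowerSeries.X, ← MvPowerSeries.monomial_zero_eq_C_apply, MvPowerSeries.monomial_mul_monomial]
  simp [sdw, rtv]
lemma xv_inr (ij : Fin 3 × Fin 3) : xv (Sum.inr ij) = vt * Zc (rt ij) := by
  rw [xv, vt, Zc, MvPowerSeries.X, ← MvPowerSeries.monomial_zero_eq_C_apply, MvPowerSeries.monomial_mul_monomial]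
  simp [sdw, rtv]

def fs (g : ℤ × ℤ) : BB := 1 - vs * Zc g
def ft (g : ℤ × ℤ) : BB := 1 - vt * Zc g
def den : BB := fs 0 ^ 3 * ft 0 ^ 3 * (fs (1, 0) * fs (0, 1) * fs (1, 1) * ft (1, 0) * ft (0, 1) * ft (1, 1)
    * ft (-1, 0) * ft (0, -1) * ft (-1, -1)) * (fs (-1, 0) * fs (0, -1) * fs (-1, -1))

lemma Om_den : Om * den = 1 := by
  refine Eq.trans ?_ Om_prod
  refine congrArg (Om * ·) ?_
  rw [Fintype.prod_sum_type, Fintype.prod_prod_type, Fintype.prod_prod_type]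
  have h1 : ∀ ij, 1 - xv (Sum.inl ij) = fs (rt ij) := fun ij => by rw [xv_inl, fs]
  have h2 : ∀ ij, 1 - xv (Sum.inr ij) = ft (rt ij) := fun ij => by rw [xv_inr, ft]
  simp only [Fin.prod_univ_three, h1, h2]
  have e00 : rt (0, 0) = 0 := rfl
  have e01 : rt (0, 1) = (1, 0) := rfl
  have e02 : rt (0, 2) = (1, 1) := rfl
  have e10 : rt (1, 0) = (-1, 0) := rfl
  have e11 : rt (1, 1) = 0 := rfl
  have e12 : rt (1, 2) = (0, 1) := rfl
  have e20 : rt (2, 0) = (-1, -1) := rfl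
  have e21 : rt (2, 1) = (0, -1) := rfl
  have e22 : rt (2, 2) = 0 := rfl
  rw [e00, e01, e02, e10, e11, e12, e20, e21, e22, den]
  ring

/-- change of Laurent variables -/
def sg (g : ℤ × ℤ →+ ℤ × ℤ) : BB →+* BB := MvPowerSeries.map (AddMonoidAlgebra.mapDomainRingHom ℚ g)

lemma sg_Zc (g : ℤ × ℤ →+ ℤ × ℤ) (h : ℤ × ℤ) : sg g (Zc h) = Zc (g h) := by
  simp [sg, Zc, zz]
lemma sg_s (g : ℤ × ℤ →+ ℤ × ℤ) : sg g vs = vs := by simp [sg, vs]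
lemma sg_t (g : ℤ × ℤ →+ ℤ × ℤ) : sg g vt = vt := by simp [sg, vt]
lemma CT_sg (g : ℤ × ℤ →+ ℤ × ℤ) (hg : Function.Injective g) (f : BB) : CT (sg g f) = CT f := by
  ext e
  rw [coeff_CT, coeff_CT, sg, MvPowerSeries.coeff_map]
  have := Finsupp.mapDomain_apply hg (MvPowerSeries.coeff e f).coeff 0
  rw [map_zero] at this
  exact this

def g1 : ℤ × ℤ →+ ℤ × ℤ := AddMonoidHom.mk' (fun x => (-x.1 + x.2, x.2)) (by
  intro x y; ext <;> simp; ring)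
def g2 : ℤ × ℤ →+ ℤ × ℤ := AddMonoidHom.mk' (fun x => (x.1, x.1 - x.2)) (by
  intro x y; ext <;> simp; ring)
lemma g1_inj : Function.Injective g1 := by
  intro x y h
  have h1 : -x.1 + x.2 = -y.1 + y.2 := (Prod.ext_iff.1 h).1
  have h2 : x.2 = y.2 := (Prod.ext_iff.1 h).2
  ext <;> omega
lemma g2_inj : Function.Injective g2 := by
  intro x y h
  have h1 : x.1 = y.1 := (Prod.ext_iff.1 h).1
  have h2 : x.1 - x.2 = y.1 - y.2 := (Prod.ext_iff.1 h).2
  ext <;> omega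

lemma g1a : sg g1 va = wa := by rw [va, sg_Zc]; rfl
lemma g1b : sg g1 vb = va * vb := by rw [← Zc_ab, vb, sg_Zc]; rfl
lemma g1a' : sg g1 wa = va := by rw [wa, sg_Zc]; rfl
lemma g1b' : sg g1 wb = wa * wb := by rw [← Zc_ab', wb, sg_Zc]; rfl
lemma g2a : sg g2 va = va * vb := by rw [← Zc_ab, va, sg_Zc]; rfl
lemma g2b : sg g2 vb = wb := by rw [vb, sg_Zc]; rfl
lemma g2a' : sg g2 wa = wa * wb := by rw [← Zc_ab', wa, sg_Zc]; rfl
lemma g2b' : sg g2 wb = vb := by rw [wb, sg_Zc]; rfl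
lemma g1ab : sg g1 (va * vb) = vb := by rw [map_mul, g1a, g1b]; linear_combination vb * ha
lemma g1ab' : sg g1 (wa * wb) = wb := by rw [map_mul, g1a', g1b']; linear_combination wb * ha
lemma g2ab : sg g2 (va * vb) = va := by rw [map_mul, g2a, g2b]; linear_combination va * hb
lemma g2ab' : sg g2 (wa * wb) = wa := by rw [map_mul, g2a', g2b']; linear_combination wa * hb

lemma den_fix (φ : BB →+* BB) (h : φ den = den) : φ Om = Om := by
  have h1 := congrArg φ Om_den
  rw [map_mul, h, map_one] at h1
  have h2 := Om_den
  linear_combination Om * h1 - φ Om * h2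

lemma sg_fs (g : ℤ × ℤ →+ ℤ × ℤ) (h : ℤ × ℤ) : sg g (fs h) = fs (g h) := by
  rw [fs, map_sub, map_mul, map_one, sg_s, sg_Zc, fs]
lemma sg_ft (g : ℤ × ℤ →+ ℤ × ℤ) (h : ℤ × ℤ) : sg g (ft h) = ft (g h) := by
  rw [ft, map_sub, map_mul, map_one, sg_t, sg_Zc, ft]
lemma g1_Om : sg g1 Om = Om := by
  refine den_fix _ ?_
  have e0 : g1 (1, 0) = (-1, 0) := rfl
  have e1 : g1 (0, 1) = (1, 1) := rfl
  have e2 : g1 (1, 1) = (0, 1) := rfl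
  have e3 : g1 (-1, 0) = (1, 0) := rfl
  have e4 : g1 (0, -1) = (-1, -1) := rfl
  have e5 : g1 (-1, -1) = (0, -1) := rfl
  simp only [den, map_mul, map_pow, sg_fs, sg_ft, e0, e1, e2, e3, e4, e5, map_zero]
  ring
lemma g2_Om : sg g2 Om = Om := by
  refine den_fix _ ?_
  have e0 : g2 (1, 0) = (1, 1) := rfl
  have e1 : g2 (0, 1) = (0, -1) := rfl
  have e2 : g2 (1, 1) = (1, 0) := rfl
  have e3 : g2 (-1, 0) = (-1, -1) := rfl
  have e4 : g2 (0, -1) = (0, 1) := rfl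
  have e5 : g2 (-1, -1) = (-1, 0) := rfl
  simp only [den, map_mul, map_pow, sg_fs, sg_ft, e0, e1, e2, e3, e4, e5, map_zero]
  ring

lemma CT1 (f : BB) : CT (sg g1 f * Om) = CT (f * Om) := by
  rw [← CT_sg g1 g1_inj (f * Om), map_mul (sg g1), g1_Om]
lemma CT2 (f : BB) : CT (sg g2 f * Om) = CT (f * Om) := by
  rw [← CT_sg g2 g2_inj (f * Om), map_mul (sg g2), g2_Om]

lemma weyl_id {R : Type*} [CommRing R] (s a b a' b' : R) (ha : a * a' = 1) (hb : b * b' = 1) :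
    (1 - s * a') * (1 - s * b') * (1 - s * (a' * b')) * (1 + a * b * (1 + s))
    - a' * ((1 - s * a) * (1 - s * (a' * b')) * (1 - s * b') * (1 + b * (1 + s)))
    - b' * ((1 - s * (a' * b')) * (1 - s * b) * (1 - s * a') * (1 + a * (1 + s)))
    + a' ^ 2 * b' * ((1 - s * b') * (1 - s * (a * b)) * (1 - s * a) * (1 + a' * (1 + s)))
    + a' * b' ^ 2 * ((1 - s * (a * b)) * (1 - s * a') * (1 - s * b) * (1 + b' * (1 + s)))
    - a' ^ 2 * b' ^ 2 * ((1 - s * b) * (1 - s * a) * (1 - s * (a * b)) * (1 + a' * b' * (1 + s)))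
    = (1 + s) * (3 + a + b + a * b + a' + b' + a' * b') * (1 - a' - b' + a' ^ 2 * b' + a' * b' ^ 2 - a' ^ 2 * b' ^ 2) := by
  grind


lemma weyl_full {R : Type*} [CommRing R] (s a b p a' b' p' : R) (ha : a * a' = 1) (hb : b * b' = 1)
    (hp : p = a * b) (hp' : p' = a' * b') :
    ((1 - a) * (1 - b) * (1 - p)) * ((1 - s * a') * (1 - s * b') * (1 - s * p') * (1 + p * (1 + s)))
    + ((1 - a') * (1 - p) * (1 - b)) * ((1 - s * a) * (1 - s * p') * (1 - s * b') * (1 + b * (1 + s)))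
    + ((1 - p) * (1 - b') * (1 - a)) * ((1 - s * p') * (1 - s * b) * (1 - s * a') * (1 + a * (1 + s)))
    + ((1 - b) * (1 - p') * (1 - a')) * ((1 - s * b') * (1 - s * p) * (1 - s * a) * (1 + a' * (1 + s)))
    + ((1 - p') * (1 - a) * (1 - b')) * ((1 - s * p) * (1 - s * a') * (1 - s * b) * (1 + b' * (1 + s)))
    + ((1 - b') * (1 - a') * (1 - p')) * ((1 - s * b) * (1 - s * a) * (1 - s * p) * (1 + p' * (1 + s)))
    = (1 + s) * (3 + a + b + p + a' + b' + p') * (((1 - a) * (1 - b) * (1 - p))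
      + ((1 - a') * (1 - p) * (1 - b)) + ((1 - p) * (1 - b') * (1 - a)) + ((1 - b) * (1 - p') * (1 - a'))
      + ((1 - p') * (1 - a) * (1 - b')) + ((1 - b') * (1 - a') * (1 - p'))) := by
  subst hp hp'
  have h1 : (1 - a') * (1 - a * b) * (1 - b) = - a' * ((1 - a) * (1 - b) * (1 - a * b)) := by grind
  have h2 : (1 - a * b) * (1 - b') * (1 - a) = - b' * ((1 - a) * (1 - b) * (1 - a * b)) := by grind
  have h3 : (1 - b) * (1 - a' * b') * (1 - a') = a' ^ 2 * b' * ((1 - a) * (1 - b) * (1 - a * b)) := by grind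
  have h4 : (1 - a' * b') * (1 - a) * (1 - b') = a' * b' ^ 2 * ((1 - a) * (1 - b) * (1 - a * b)) := by grind
  have h5 : (1 - b') * (1 - a') * (1 - a' * b') = - (a' ^ 2 * b' ^ 2) * ((1 - a) * (1 - b) * (1 - a * b)) := by grind
  rw [h1, h2, h3, h4, h5]
  have hw := weyl_id s a b a' b' ha hb
  generalize (1 - a) * (1 - b) * (1 - a * b) = U
  linear_combination U * hw

end TR

namespace TR

def ww (f : BB) : BB := f + sg g1 f + sg g2 f + sg g1 (sg g2 f) + sg g2 (sg g1 f) + sg g1 (sg g2 (sg g1 f))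

lemma CT_ww (f : BB) : CT (ww f * Om) = 6 * CT (f * Om) := by
  rw [ww, add_mul, add_mul, add_mul, add_mul, add_mul, map_add, map_add, map_add, map_add, map_add]
  rw [CT1 (sg g2 (sg g1 f)), CT2 (sg g1 f), CT1 (sg g2 f), CT1, CT2]
  ring

def UZ : BB := (1 - Zc (1, 0)) * (1 - Zc (0, 1)) * (1 - Zc (1, 1))
def EZ : BB := fs (-1, 0) * fs (0, -1) * fs (-1, -1) * (1 + Zc (1, 1) * (1 + vs))
def chiZ : BB := 3 + Zc (1, 0) + Zc (0, 1) + Zc (1, 1) + Zc (-1, 0) + Zc (0, -1) + Zc (-1, -1)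

lemma e11 : g1 (1, 0) = (-1, 0) := rfl
lemma e12 : g1 (0, 1) = (1, 1) := rfl
lemma e13 : g1 (1, 1) = (0, 1) := rfl
lemma e14 : g1 (-1, 0) = (1, 0) := rfl
lemma e15 : g1 (0, -1) = (-1, -1) := rfl
lemma e16 : g1 (-1, -1) = (0, -1) := rfl
lemma e21 : g2 (1, 0) = (1, 1) := rfl
lemma e22 : g2 (0, 1) = (0, -1) := rfl
lemma e23 : g2 (1, 1) = (1, 0) := rfl
lemma e24 : g2 (-1, 0) = (-1, -1) := rfl
lemma e25 : g2 (0, -1) = (0, 1) := rfl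
lemma e26 : g2 (-1, -1) = (-1, 0) := rfl

lemma chi1 : sg g1 chiZ = chiZ := by
  simp only [chiZ, map_add, sg_Zc, e11, e12, e13, e14, e15, e16, map_ofNat]; ring
lemma chi2 : sg g2 chiZ = chiZ := by
  simp only [chiZ, map_add, sg_Zc, e21, e22, e23, e24, e25, e26, map_ofNat]; ring

lemma ww_chi (f : BB) : ww ((1 + vs) * chiZ * f) = (1 + vs) * chiZ * ww f := by
  have h1 : ∀ x, sg g1 ((1 + vs) * chiZ * x) = (1 + vs) * chiZ * sg g1 x := fun x => by
    rw [map_mul, map_mul, chi1, map_add, map_one, sg_s]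
  have h2 : ∀ x, sg g2 ((1 + vs) * chiZ * x) = (1 + vs) * chiZ * sg g2 x := fun x => by
    rw [map_mul, map_mul, chi2, map_add, map_one, sg_s]
  rw [ww, h1, h2, h1, h2, h1, ww]
  ring

lemma ww_U : ww UZ = UZ + ((1 - Zc (-1, 0)) * (1 - Zc (1, 1)) * (1 - Zc (0, 1)))
    + ((1 - Zc (1, 1)) * (1 - Zc (0, -1)) * (1 - Zc (1, 0)))
    + ((1 - Zc (0, 1)) * (1 - Zc (-1, -1)) * (1 - Zc (-1, 0)))
    + ((1 - Zc (-1, -1)) * (1 - Zc (1, 0)) * (1 - Zc (0, -1)))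
    + ((1 - Zc (0, -1)) * (1 - Zc (-1, 0)) * (1 - Zc (-1, -1))) := by
  simp only [ww, UZ, map_mul, map_sub, map_one, sg_Zc, e11, e12, e13, e14, e15, e16, e21, e22, e23, e24, e25, e26]

lemma ww_UE : ww (UZ * EZ) = (1 + vs) * chiZ * ww UZ := by
  have h := weyl_full vs va vb (Zc (1, 1)) wa wb (Zc (-1, -1)) ha hb Zc_ab Zc_ab'
  rw [ww_U]
  simp only [ww, UZ, EZ, chiZ, map_mul, map_sub, map_add, map_one, sg_Zc, sg_fs, sg_s, e11, e12, e13, e14, e15, e16, e21, e22, e23, e24, e25, e26, fs]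
  exact h

lemma CT_UE : CT (UZ * EZ * Om) = CT ((1 + vs) * chiZ * UZ * Om) := by
  have h := CT_ww (UZ * EZ)
  rw [ww_UE, ← ww_chi, CT_ww] at h
  have h6 : (6 : MvPowerSeries (Fin 2) ℚ) ≠ 0 := by
    intro h
    have := congrArg (MvPowerSeries.constantCoeff) h
    rw [map_ofNat, map_zero] at this
    norm_num at this
  exact (mul_left_cancel₀ h6 h).symm

/-- scalars -/
def io : MvPowerSeries (Fin 2) ℚ →+* BB := MvPowerSeries.map (algebraMap ℚ LA)

lemma io_X (i : Fin 2) : io (MvPowerSeries.X i) = MvPowerSeries.X i := by simp [io]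

lemma CT_io_mul (p : MvPowerSeries (Fin 2) ℚ) (f : BB) : CT (io p * f) = p * CT f := by
  classical
  ext e
  rw [coeff_CT, MvPowerSeries.coeff_mul, MvPowerSeries.coeff_mul]
  have : ∀ (S : Finset ((Fin 2 →₀ ℕ) × (Fin 2 →₀ ℕ))) (u : (Fin 2 →₀ ℕ) × (Fin 2 →₀ ℕ) → LA), (∑ x ∈ S, u x).coeff 0 = ∑ x ∈ S, (u x).coeff 0 := by
    intro S u
    induction S using Finset.induction_on with
    | empty => rfl
    | insert a S ha ih => rw [Finset.sum_insert ha, Finset.sum_insert ha, ← ih]; rfl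
  rw [this]
  refine Finset.sum_congr rfl fun x _ => ?_
  rw [coeff_CT, io, MvPowerSeries.coeff_map, ← Algebra.smul_def]
  rfl

lemma CT_one : CT 1 = 1 := by
  classical
  ext e
  rw [coeff_CT, MvPowerSeries.coeff_one, MvPowerSeries.coeff_one]
  split_ifs
  · rw [AddMonoidAlgebra.one_def]; exact Finsupp.single_eq_same
  · rfl

lemma CT_io (p : MvPowerSeries (Fin 2) ℚ) : CT (io p) = p := by
  rw [← mul_one (io p), CT_io_mul, CT_one, mul_one]

lemma io_s : io (MvPowerSeries.X 0) = vs := io_X 0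
lemma io_t : io (MvPowerSeries.X 1) = vt := io_X 1

lemma CT_main (K : Type*) [Field K] [CharZero K] :
    (1 + MvPowerSeries.X 0) * mixedPS2 K 3 = CT (UZ * EZ * Om) := by
  rw [CT_UE, mixedPS2_eq, ← CT_io_mul, map_add, map_one, io_s]
  congr 1
  rw [Udef_eq, chi_eq, UZ, chiZ, Zc_ab, Zc_ab', Zc_a, Zc_b, Zc_a', Zc_b']
  ring

end TR

namespace TR

def II {R : Type*} [CommRing R] (x : MvPowerSeries (Fin 2) R) : MvPowerSeries (Fin 2) R :=
  MvPowerSeries.invOfUnit (1 - x) 1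

abbrev cc {R : Type*} [CommRing R] (x : MvPowerSeries (Fin 2) R) : R := MvPowerSeries.constantCoeff x

lemma II_spec {R : Type*} [CommRing R] {x : MvPowerSeries (Fin 2) R} (h : cc x = 0) : (1 - x) * II x = 1 := by
  refine MvPowerSeries.mul_invOfUnit _ _ ?_
  rw [map_sub, map_one]
  rw [show MvPowerSeries.constantCoeff x = 0 from h]
  simp

lemma II_unique {R : Type*} [CommRing R] {x y : MvPowerSeries (Fin 2) R} (h : cc x = 0) (hy : (1 - x) * y = 1) : y = II x := by
  have h1 := II_spec h
  linear_combination II x * hy - y * h1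

lemma map_II {R S : Type*} [CommRing R] [CommRing S] (φ : R →+* S) {x : MvPowerSeries (Fin 2) R} (h : cc x = 0) :
    MvPowerSeries.map φ (II x) = II (MvPowerSeries.map φ x) := by
  refine II_unique ?_ ?_
  · have : cc (MvPowerSeries.map φ x) = φ (cc x) := by simp [cc]
    rw [this, h, map_zero]
  · have := congrArg (MvPowerSeries.map φ) (II_spec h)
    simpa using this

def NS (S : AddSubmonoid (ℤ × ℤ)) : Subring BB :=
  (MvPowerSeries.map (σ := Fin 2) (AddMonoidAlgebra.mapDomainRingHom ℚ S.subtype)).range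

lemma NS_II {S : AddSubmonoid (ℤ × ℤ)} {x : BB} (hx : x ∈ NS S) (h : cc x = 0) : II x ∈ NS S := by
  obtain ⟨y, rfl⟩ := hx
  refine ⟨II y, ?_⟩
  refine map_II _ ?_
  have h1 : cc (MvPowerSeries.map (AddMonoidAlgebra.mapDomainRingHom ℚ S.subtype) y)
    = (AddMonoidAlgebra.mapDomainRingHom ℚ S.subtype) (cc y) := by simp [cc]
  rw [h1] at h
  have : Function.Injective (AddMonoidAlgebra.mapDomainRingHom ℚ S.subtype) :=
    AddMonoidAlgebra.mapDomain_injective Subtype.val_injective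
  exact this (h.trans (map_zero _).symm)

lemma NS_mono {S T : AddSubmonoid (ℤ × ℤ)} (hST : S ≤ T) {x : BB} (hx : x ∈ NS S) : x ∈ NS T := by
  obtain ⟨y, rfl⟩ := hx
  refine ⟨MvPowerSeries.map (AddMonoidAlgebra.mapDomainRingHom ℚ (AddSubmonoid.inclusion hST)) y, ?_⟩
  rw [← RingHom.comp_apply, ← MvPowerSeries.map_comp]
  congr 2
  ext <;> simp

lemma NS_Zc {S : AddSubmonoid (ℤ × ℤ)} {g : ℤ × ℤ} (hg : g ∈ S) : Zc g ∈ NS S := by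
  refine ⟨MvPowerSeries.C (AddMonoidAlgebra.single ⟨g, hg⟩ 1), ?_⟩
  simp [Zc, zz]

lemma NS_s (S : AddSubmonoid (ℤ × ℤ)) : vs ∈ NS S := ⟨MvPowerSeries.X 0, by simp [vs]⟩
lemma NS_t (S : AddSubmonoid (ℤ × ℤ)) : vt ∈ NS S := ⟨MvPowerSeries.X 1, by simp [vt]⟩

lemma CT_zero {S : AddSubmonoid (ℤ × ℤ)} {h : BB} (hh : h ∈ NS S) {g : ℤ × ℤ} (hg : -g ∉ S) : CT (Zc g * h) = 0 := by
  obtain ⟨y, rfl⟩ := hh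
  ext e
  rw [coeff_CT, Zc, MvPowerSeries.coeff_C_mul, MvPowerSeries.coeff_map, zz]
  refine (AddMonoidAlgebra.coeff_single_mul_apply _ _ _ _).trans ?_
  rw [one_mul, add_zero]
  refine Finsupp.mapDomain_of_notMem_range _ _ ?_
  rintro ⟨w, hw⟩
  exact hg (hw ▸ w.2)

def Sp (l : ℤ × ℤ →+ ℤ) : AddSubmonoid (ℤ × ℤ) := (AddSubmonoid.nonneg ℤ).comap l
def Sm (l : ℤ × ℤ →+ ℤ) : AddSubmonoid (ℤ × ℤ) := (AddSubmonoid.nonneg ℤ).comap (-l)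
def S0 (l : ℤ × ℤ →+ ℤ) : AddSubmonoid (ℤ × ℤ) := (⊥ : AddSubmonoid ℤ).comap l
lemma mSp {l : ℤ × ℤ →+ ℤ} {g : ℤ × ℤ} : g ∈ Sp l ↔ 0 ≤ l g := Iff.rfl
lemma mSm {l : ℤ × ℤ →+ ℤ} {g : ℤ × ℤ} : g ∈ Sm l ↔ 0 ≤ - l g := Iff.rfl
lemma mS0 {l : ℤ × ℤ →+ ℤ} {g : ℤ × ℤ} : g ∈ S0 l ↔ l g = 0 := Iff.rfl
lemma S0p (l : ℤ × ℤ →+ ℤ) : S0 l ≤ Sp l := fun x hx => by rw [mSp]; rw [mS0] at hx; omega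
lemma S0m (l : ℤ × ℤ →+ ℤ) : S0 l ≤ Sm l := fun x hx => by rw [mSm]; rw [mS0] at hx; omega

structure Ev (l : ℤ × ℤ →+ ℤ) (z c g r : BB) : Prop where
  dv : ∃ h ∈ NS (Sp l), g - r = (z - c) * h
  hg : g ∈ NS (Sp l)
  hr : r ∈ NS (S0 l)

variable {l : ℤ × ℤ →+ ℤ} {z c g r g' r' : BB}

lemma Ev.const (hr : r ∈ NS (S0 l)) : Ev l z c r r :=
  ⟨⟨0, zero_mem _, by ring⟩, NS_mono (S0p l) hr, hr⟩
lemma Ev.var (hz : z ∈ NS (Sp l)) (hc : c ∈ NS (S0 l)) : Ev l z c z c :=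
  ⟨⟨1, one_mem _, by ring⟩, hz, hc⟩
lemma Ev.add (h : Ev l z c g r) (h' : Ev l z c g' r') : Ev l z c (g + g') (r + r') := by
  obtain ⟨⟨k, hk, e⟩, hg, hr⟩ := h
  obtain ⟨⟨k', hk', e'⟩, hg', hr'⟩ := h'
  exact ⟨⟨k + k', add_mem hk hk', by linear_combination e + e'⟩, add_mem hg hg', add_mem hr hr'⟩
lemma Ev.sub (h : Ev l z c g r) (h' : Ev l z c g' r') : Ev l z c (g - g') (r - r') := by
  obtain ⟨⟨k, hk, e⟩, hg, hr⟩ := h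
  obtain ⟨⟨k', hk', e'⟩, hg', hr'⟩ := h'
  exact ⟨⟨k - k', sub_mem hk hk', by linear_combination e - e'⟩, sub_mem hg hg', sub_mem hr hr'⟩
lemma Ev.mul (h : Ev l z c g r) (h' : Ev l z c g' r') : Ev l z c (g * g') (r * r') := by
  obtain ⟨⟨k, hk, e⟩, hg, hr⟩ := h
  obtain ⟨⟨k', hk', e'⟩, hg', hr'⟩ := h'
  exact ⟨⟨k * g' + r * k', add_mem (mul_mem hk hg') (mul_mem (NS_mono (S0p l) hr) hk'),
    by linear_combination g' * e + r * e'⟩, mul_mem hg hg', mul_mem hr hr'⟩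
lemma Ev.one : Ev l z c 1 1 := Ev.const (one_mem _)
lemma Ev.inv (h : Ev l z c g r) (h1 : cc g = 0) (h2 : cc r = 0) : Ev l z c (II g) (II r) := by
  obtain ⟨⟨k, hk, e⟩, hg, hr⟩ := h
  have i1 := NS_II hg h1
  have i2 := NS_II hr h2
  refine ⟨⟨II g * II r * k, mul_mem (mul_mem i1 (NS_mono (S0p l) i2)) hk, ?_⟩, i1, i2⟩
  have e1 := II_spec h1
  have e2 := II_spec h2
  linear_combination II g * II r * e - II g * e2 + II r * e1

lemma Ev.CT {u : ℤ × ℤ} {g r c : BB} (h : Ev l (Zc u) c g r) (hu : 0 < l u) (hc : c ∈ NS (S0 l)) (hc0 : cc c = 0) :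
    CT (g * II (c * Zc (-u))) = CT r := by
  obtain ⟨⟨k, hk, e⟩, hg, hr⟩ := h
  have hzz : Zc u * Zc (-u) = 1 := by rw [Zc_mul, add_neg_cancel, Zc_zero]
  have hm : Zc (-u) ∈ NS (Sm l) := NS_Zc (by rw [mSm, map_neg]; omega)
  have h0 : cc (c * Zc (-u)) = 0 := by rw [cc, map_mul, show MvPowerSeries.constantCoeff c = 0 from hc0, zero_mul]
  have hc' := NS_mono (S0m l) hc
  have hr' := NS_mono (S0m l) hr
  have hJ := NS_II (mul_mem hc' hm) h0
  have hs := II_spec h0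
  have e1 : g * II (c * Zc (-u)) = r + Zc (-u) * (r * c * II (c * Zc (-u))) + Zc u * k := by
    linear_combination II (c * Zc (-u)) * e + (r + k * Zc u) * hs + (k * c * II (c * Zc (-u))) * hzz
  rw [e1, map_add, map_add, CT_zero (mul_mem (mul_mem hr' hc') hJ) (by rw [neg_neg, mSm]; omega),
    CT_zero hk (by rw [mSp, map_neg]; omega), add_zero, add_zero]

end TR

namespace TR

lemma cs (x : BB) : cc (vs * x) = 0 := by simp [cc, vs]
lemma ct (x : BB) : cc (vt * x) = 0 := by simp [cc, vt]

def l1 : ℤ × ℤ →+ ℤ := AddMonoidHom.fst ℤ ℤ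
def l2 : ℤ × ℤ →+ ℤ := AddMonoidHom.snd ℤ ℤ

lemma n1b : vb ∈ NS (S0 l1) := NS_Zc rfl
lemma n1b' : wb ∈ NS (S0 l1) := NS_Zc rfl
lemma n1a : va ∈ NS (Sp l1) := NS_Zc (by rw [mSp]; decide)
lemma n2b : vb ∈ NS (Sp l2) := NS_Zc (by rw [mSp]; decide)

lemma evs {l : ℤ × ℤ →+ ℤ} {z c : BB} : Ev l z c vs vs := Ev.const (NS_s _)
lemma evt {l : ℤ × ℤ →+ ℤ} {z c : BB} : Ev l z c vt vt := Ev.const (NS_t _)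

/-- the common part, as a function of the first variable -/
def WW (a b : BB) : BB := (1 - a) * (1 - a * b) * (1 + a * b * (1 + vs)) * II (vs * a) * II (vs * b) * II (vs * (a * b))
  * II (vt * a) * II (vt * b) * II (vt * (a * b))

lemma evW {c : BB} (hc : c ∈ NS (S0 l1)) : Ev l1 va c (WW va vb) (WW c vb) := by
  have a : Ev l1 va c va c := Ev.var n1a hc
  have b : Ev l1 va c vb vb := Ev.const n1b
  have ab := a.mul b
  exact (((((((((Ev.one.sub a).mul (Ev.one.sub ab)).mul (Ev.one.add (ab.mul (Ev.one.add evs)))).mul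
    ((evs.mul a).inv (cs _) (cs _))).mul ((evs.mul b).inv (cs _) (cs _))).mul ((evs.mul ab).inv (cs _) (cs _))).mul
    ((evt.mul a).inv (ct _) (ct _))).mul ((evt.mul b).inv (ct _) (ct _))).mul ((evt.mul ab).inv (ct _) (ct _)))

def FF : BB := (1 - va) * (1 - vb) * (1 - va * vb) * (1 + va * vb * (1 + vs)) * II (vs * va) * II (vs * vb) * II (vs * (va * vb))
  * II (vt * va) * II (vt * vb) * II (vt * (va * vb)) * II (vt * wa) * II (vt * wb) * II (vt * (wa * wb))

lemma FF_eq : FF = WW va vb * (0 - vb) * II (vt * wb) * II (vt * wa) + WW va vb * II (vt * wb) * II (vt * wb * wa) := by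
  have h1 := II_spec (ct wa)
  have h2 := II_spec (ct (wa * wb))
  have h : (1 - vb) * II (vt * wa) * II (vt * (wa * wb)) = - vb * II (vt * wa) + II (vt * (wa * wb)) := by
    linear_combination (II (vt * (wa * wb))) * h1 - vb * II (vt * wa) * h2 + (-vt * wa * II (vt * wa) * II (vt * (wa * wb))) * hb
  rw [show vt * wb * wa = vt * (wa * wb) by ring, FF, WW]
  linear_combination ((1 - va) * (1 - va * vb) * (1 + va * vb * (1 + vs)) * II (vs * va) * II (vs * vb) * II (vs * (va * vb))
    * II (vt * va) * II (vt * vb) * II (vt * (va * vb)) * II (vt * wb)) * h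

lemma t1a : CT (WW va vb * (0 - vb) * II (vt * wb) * II (vt * wa)) = CT (WW vt vb * (0 - vb) * II (vt * wb)) := by
  have b : Ev l1 va vt vb vb := Ev.const n1b
  have b' : Ev l1 va vt wb wb := Ev.const n1b'
  have z : Ev l1 va vt 0 0 := Ev.const (zero_mem _)
  have h := ((evW (NS_t _)).mul (z.sub b)).mul ((evt.mul b').inv (ct _) (ct _))
  exact Ev.CT (u := (1, 0)) h (by decide) (NS_t _) (by simp [cc, vt])

lemma t2a : CT (WW va vb * II (vt * wb) * II (vt * wb * wa)) = CT (WW (vt * wb) vb * II (vt * wb)) := by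
  have b' : Ev l1 va (vt * wb) wb wb := Ev.const n1b'
  have h := ((evW (mul_mem (NS_t _) n1b')).mul ((evt.mul b').inv (ct _) (ct _)))
  exact Ev.CT (u := (1, 0)) h (by decide) (mul_mem (NS_t _) n1b') (ct _)

def R1 (c : BB) : BB := (0 - c) * (1 - vt) * (1 + vt * c * (1 + vs)) * II (vs * vt) * II (vs * c) * II (vs * (vt * c))
  * II (vt * vt) * II (vt * (vt * c))

lemma t1b : CT (WW vt vb * (0 - vb) * II (vt * wb)) = CT (R1 vt) := by
  have h1 := II_spec (ct vb)
  have e : WW vt vb * (0 - vb) * II (vt * wb) = R1 vb * II (vt * wb) := by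
    rw [WW, R1]
    linear_combination ((0 - vb) * (1 - vt) * (1 + vt * vb * (1 + vs)) * II (vs * vt) * II (vs * vb) * II (vs * (vt * vb))
      * II (vt * vt) * II (vt * (vt * vb)) * II (vt * wb)) * h1
  rw [e]
  have b : Ev l2 vb vt vb vt := Ev.var n2b (NS_t _)
  have z : Ev l2 vb vt 0 0 := Ev.const (zero_mem _)
  have h : Ev l2 vb vt (R1 vb) (R1 vt) := (((((((z.sub b).mul (Ev.one.sub evt)).mul (Ev.one.add ((evt.mul b).mul (Ev.one.add evs)))).mul
    ((evs.mul evt).inv (cs _) (cs _))).mul ((evs.mul b).inv (cs _) (cs _))).mul ((evs.mul (evt.mul b)).inv (cs _) (cs _))).mul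
    ((evt.mul evt).inv (ct _) (ct _))).mul ((evt.mul (evt.mul b)).inv (ct _) (ct _))
  exact Ev.CT (u := (0, 1)) h (by decide) (NS_t _) (by simp [cc, vt])

def M2 : BB := (1 - vt) * (1 + vt * (1 + vs)) * II (vs * vt) * II (vt * vt)
def R2 (c : BB) : BB := M2 * II (vs * c) * II (vt * c)

lemma t2b : (vs * vt - vt * vt) * (WW (vt * wb) vb * II (vt * wb)) =
    vs * vt * (R2 vb * II (vs * vt * wb)) - vt * vt * (R2 vb * II (vt * vt * wb)) := by
  have e : vt * wb * vb = vt := by linear_combination vt * hb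
  have h1 := II_spec (ct wb)
  have h2 := II_spec (cs (vt * wb))
  have h3 := II_spec (ct (vt * wb))
  rw [WW, e, R2, mul_assoc vs vt wb, mul_assoc vt vt wb, M2]
  have h4 : (vs * vt - vt * vt) * (II (vs * (vt * wb)) * II (vt * (vt * wb))) =
      vs * vt * II (vs * (vt * wb)) - vt * vt * II (vt * (vt * wb)) := by
    linear_combination (vs * vt * II (vs * (vt * wb))) * h3 - vt * vt * II (vt * (vt * wb)) * h2
  linear_combination ((1 - vt) * (1 + vt * (1 + vs)) * II (vs * vt) * II (vt * vt) * II (vs * vb) * II (vt * vb)) * h4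
    + ((vs * vt - vt * vt) * (II (vs * (vt * wb)) * II (vt * (vt * wb))) * ((1 - vt) * (1 + vt * (1 + vs)) * II (vs * vt) * II (vt * vt) * II (vs * vb) * II (vt * vb))) * h1

lemma t2c {c : BB} (hc : c ∈ NS (S0 l2)) (hc0 : cc c = 0) : CT (R2 vb * II (c * wb)) = CT (R2 c) := by
  have b : Ev l2 vb c vb c := Ev.var n2b hc
  have h : Ev l2 vb c (R2 vb) (R2 c) := ((((((Ev.one.sub evt).mul (Ev.one.add (evt.mul (Ev.one.add evs)))).mul
    ((evs.mul evt).inv (cs _) (cs _))).mul ((evt.mul evt).inv (ct _) (ct _)))).mul ((evs.mul b).inv (cs _) (cs _))).mul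
    ((evt.mul b).inv (ct _) (ct _))
  exact Ev.CT (u := (0, 1)) h (by decide) hc hc0

lemma FF_CT : CT ((vs * vt - vt * vt) * FF) = CT ((vs * vt - vt * vt) * R1 vt + (vs * vt * R2 (vs * vt) - vt * vt * R2 (vt * vt))) := by
  have hst : vs * vt = io (MvPowerSeries.X 0 * MvPowerSeries.X 1) := by rw [map_mul, io_s, io_t]
  have htt : vt * vt = io (MvPowerSeries.X 1 * MvPowerSeries.X 1) := by rw [map_mul, io_t]
  have hd : vs * vt - vt * vt = io (MvPowerSeries.X 0 * MvPowerSeries.X 1 - MvPowerSeries.X 1 * MvPowerSeries.X 1) := by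
    rw [map_sub, hst, htt]
  rw [FF_eq, mul_add, map_add, map_add, map_sub]
  refine congrArg₂ (· + ·) ?_ ?_
  · rw [hd, CT_io_mul, CT_io_mul, t1a, t1b]
  · have e1 := t2c (mul_mem (NS_s _) (NS_t _)) (cs vt)
    have e2 := t2c (mul_mem (NS_t _) (NS_t _)) (ct vt)
    have f1 : ∀ f, CT (vs * vt * f) = MvPowerSeries.X 0 * MvPowerSeries.X 1 * CT f := fun f => by rw [hst, CT_io_mul]
    have f2 : ∀ f, CT (vt * vt * f) = MvPowerSeries.X 1 * MvPowerSeries.X 1 * CT f := fun f => by rw [htt, CT_io_mul]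
    rw [hd, CT_io_mul, t2a, ← CT_io_mul, ← hd, t2b, map_sub, f1, f2, f1, f2, e1, e2]

lemma cancel9 {R : Type*} [CommRing R] (P Om u q x1 x2 x3 x4 x5 x6 x7 x8 x9 y1 y2 y3 i1 i2 i3 i4 i5 i6 i7 i8 i9 : R)
    (h : Om * (P * (x1 * x2 * x3 * x4 * x5 * x6 * x7 * x8 * x9) * (y1 * y2 * y3)) = 1)
    (h1 : x1 * i1 = 1) (h2 : x2 * i2 = 1) (h3 : x3 * i3 = 1) (h4 : x4 * i4 = 1) (h5 : x5 * i5 = 1)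
    (h6 : x6 * i6 = 1) (h7 : x7 * i7 = 1) (h8 : x8 * i8 = 1) (h9 : x9 * i9 = 1) :
    P * (u * (y1 * y2 * y3 * q) * Om) = u * q * i1 * i2 * i3 * i4 * i5 * i6 * i7 * i8 * i9 := by
  have e : (x1 * i1) * (x2 * i2) * (x3 * i3) * (x4 * i4) * (x5 * i5) * (x6 * i6) * (x7 * i7) * (x8 * i8) * (x9 * i9) = 1 := by
    rw [h1, h2, h3, h4, h5, h6, h7, h8, h9]; ring
  linear_combination (u * q * i1 * i2 * i3 * i4 * i5 * i6 * i7 * i8 * i9) * h - P * (u * (y1 * y2 * y3 * q) * Om) * e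

lemma UEO : (fs 0 ^ 3 * ft 0 ^ 3) * (UZ * EZ * Om) = FF := by
  have h := Om_den
  rw [den] at h
  rw [UZ, EZ, cancel9 _ _ _ _ _ _ _ _ _ _ _ _ _ _ _ _ _ _ _ _ _ _ _ _ _ h (II_spec (cs _)) (II_spec (cs _)) (II_spec (cs _))
    (II_spec (ct _)) (II_spec (ct _)) (II_spec (ct _)) (II_spec (ct _)) (II_spec (ct _)) (II_spec (ct _))]
  rw [Zc_ab, Zc_ab', FF]
  rfl

end TR

namespace TR

lemma io_II {p : MvPowerSeries (Fin 2) ℚ} (h : cc p = 0) : io (II p) = II (io p) := map_II _ h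

lemma field_fin {F : Type*} [Field F] (s t G j1 j2 j3 j4 j5 : F)
    (ds : 1 - s ≠ 0) (dt : 1 - t ≠ 0) (dp : 1 + s ≠ 0) (t0 : t ≠ 0) (d0 : s - t ≠ 0)
    (h1 : (1 - s * t) * j1 = 1) (h2 : (1 - t * t) * j2 = 1) (h3 : (1 - s * (t * t)) * j3 = 1)
    (h4 : (1 - t * (t * t)) * j4 = 1) (h5 : (1 - s * (s * t)) * j5 = 1)
    (h : (s * t - t * t) * ((1 - s) ^ 3 * (1 - t) ^ 3) * ((1 + s) * G) =
      (s * t - t * t) * ((0 - t) * (1 - t) * (1 + t * t * (1 + s)) * j1 * j1 * j3 * j2 * j4)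
      + (s * t * ((1 - t) * (1 + t * (1 + s)) * j1 * j2 * j5 * j3)
        - t * t * ((1 - t) * (1 + t * (1 + s)) * j1 * j2 * j3 * j4))) :
    G * ((1 - s)^2*(1 - t)^2*(1 - s^2)*(1 - s*t)^2*(1 - t^2)*(1 - s^2*t)*(1 - s*t^2)) = 1 := by
  have c0 : (s * t - t * t) * ((1 - s) ^ 3 * (1 - t) ^ 3) * (1 + s) ≠ 0 := by
    rw [show s * t - t * t = t * (s - t) by ring]
    exact mul_ne_zero (mul_ne_zero (mul_ne_zero t0 d0) (mul_ne_zero (pow_ne_zero _ ds) (pow_ne_zero _ dt))) dp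
  refine mul_left_cancel₀ c0 ?_
  rw [← mul_assoc, mul_assoc _ (1 + s) G, h]
  have e : (s * t - t * t) * ((0 - t) * (1 - t) * (1 + t * t * (1 + s)) * j1 * j1 * j3 * j2 * j4)
      + (s * t * ((1 - t) * (1 + t * (1 + s)) * j1 * j2 * j5 * j3)
        - t * t * ((1 - t) * (1 + t * (1 + s)) * j1 * j2 * j3 * j4)) = (s * t - t * t) * (1 - t) * j1 ^ 2 * j2 * j3 * j5 := by
    have q1 : (s * t - t * t) * ((0 - t) * (1 - t) * (1 + t * t * (1 + s)) * j1 * j1 * j3 * j2 * j4) + (s * t * ((1 - t) * (1 + t * (1 + s)) * j1 * j2 * j5 * j3) - t * t * ((1 - t) * (1 + t * (1 + s)) * j1 * j2 * j3 * j4)) =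
        (s * t - t * t) * ((0 - t) * (1 - t) * (1 + t * t * (1 + s)) * j1 * j1 * j3 * j2 * j4) * ((1 - s * (s * t)) * j5) + (s * t * ((1 - t) * (1 + t * (1 + s)) * j1 * j2 * j5 * j3) * ((1 - s * t) * j1) * ((1 - t * (t * t)) * j4) - t * t * ((1 - t) * (1 + t * (1 + s)) * j1 * j2 * j3 * j4) * ((1 - s * t) * j1) * ((1 - s * (s * t)) * j5)) := by
      rw [h1, h4, h5]; ring
    rw [q1]
    have q2 : (s * t - t * t) * (1 - t) * j1 ^ 2 * j2 * j3 * j5 = (s * t - t * t) * (1 - t) * j1 ^ 2 * j2 * j3 * j5 * ((1 - t * (t * t)) * j4) := by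
      rw [h4, mul_one]
    rw [q2]
    ring
  rw [e]
  have q3 : ((1 - s * t) * j1) ^ 2 * ((1 - t * t) * j2) * ((1 - s * (t * t)) * j3) * ((1 - s * (s * t)) * j5) = 1 := by
    rw [h1, h2, h3, h5]; ring
  linear_combination ((s * t - t * t) * (1 - t) * ((1 - s)^2*(1 - t)^2*(1 - s^2))) * q3

lemma ne_aux {p : MvPowerSeries (Fin 2) ℚ} (e : Fin 2 →₀ ℕ) (h : MvPowerSeries.coeff e p ≠ 0) : p ≠ 0 := by
  rintro rfl; exact h (map_zero _)

lemma main (K : Type*) [Field K] [CharZero K] (s t : MvPowerSeries (Fin 2) ℚ) (hs : s = MvPowerSeries.X 0)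
    (ht : t = MvPowerSeries.X 1) : mixedPS2 K 3 *
    ((1 - s)^2*(1 - t)^2*(1 - s^2)*(1 - s*t)^2*(1 - t^2)*(1 - s^2*t)*(1 - s*t^2)) = 1 := by
  have is : io s = vs := hs ▸ io_s
  have it : io t = vt := ht ▸ io_t
  have zs : ∀ x, cc (s * x) = 0 := fun x => by simp [cc, hs]
  have zt : ∀ x, cc (t * x) = 0 := fun x => by simp [cc, ht]
  have h := CT_main K
  rw [← hs] at h
  have h0 : fs 0 = 1 - vs := by rw [fs, Zc_zero, mul_one]
  have h0' : ft 0 = 1 - vt := by rw [ft, Zc_zero, mul_one]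
  have hU := UEO
  rw [h0, h0'] at hU
  have hF := FF_CT
  have hR1 : R1 vt = io ((0 - t) * (1 - t) * (1 + t * t * (1 + s)) * II (s * t) * II (s * t) * II (s * (t * t))
      * II (t * t) * II (t * (t * t))) := by
    simp only [map_mul, map_sub, map_add, map_one, map_zero, io_II (zs _), io_II (zt _), is, it]
    rw [R1]
  have hR2 : R2 (vs * vt) = io ((1 - t) * (1 + t * (1 + s)) * II (s * t) * II (t * t) * II (s * (s * t)) * II (t * (s * t))) := by
    simp only [map_mul, map_sub, map_add, map_one, map_zero, io_II (zs _), io_II (zt _), is, it]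
    rw [R2, M2]
  have hR3 : R2 (vt * vt) = io ((1 - t) * (1 + t * (1 + s)) * II (s * t) * II (t * t) * II (s * (t * t)) * II (t * (t * t))) := by
    simp only [map_mul, map_sub, map_add, map_one, map_zero, io_II (zs _), io_II (zt _), is, it]
    rw [R2, M2]
  have e1 : (vs * vt - vt * vt) * FF = io ((s * t - t * t) * ((1 - s) ^ 3 * (1 - t) ^ 3)) * (UZ * EZ * Om) := by
    rw [← hU]
    simp only [map_mul, map_sub, map_one, map_pow, is, it]
    ring
  rw [e1, CT_io_mul, ← h, hR1, hR2, hR3, ← is, ← it, ← map_mul io s t, ← map_mul io t t, ← map_sub, ← map_mul, ← map_mul, ← map_mul,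
    ← map_sub, ← map_add, CT_io] at hF
  rw [show t * (s * t) = s * (t * t) by ring] at hF
  have j1 := II_spec (zs t)
  have j2 := II_spec (zt t)
  have j3 := II_spec (zs (t * t))
  have j4 := II_spec (zt (t * t))
  have j5 := II_spec (zs (s * t))
  let φ := algebraMap (MvPowerSeries (Fin 2) ℚ) (FractionRing (MvPowerSeries (Fin 2) ℚ))
  have inj : Function.Injective φ := IsFractionRing.injective _ _
  have ne : ∀ p, p ≠ 0 → φ p ≠ 0 := fun p hp h => hp (inj (h.trans (map_zero _).symm))
  have n0s : cc s = 0 := by simp [cc, hs]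
  have n0t : cc t = 0 := by simp [cc, ht]
  have d1 : 1 - s ≠ 0 := fun h => by have := congrArg cc h; simp [n0s] at this
  have d2 : 1 - t ≠ 0 := fun h => by have := congrArg cc h; simp [n0t] at this
  have d3 : 1 + s ≠ 0 := fun h => by have := congrArg cc h; simp [n0s] at this
  have d4 : t ≠ 0 := by 
    rw [ht]
    refine ne_aux (Finsupp.single 1 1) ?_
    classical
    rw [MvPowerSeries.coeff_X, if_pos rfl]
    exact one_ne_zero
  have d5 : s - t ≠ 0 := by
    rw [sub_ne_zero, hs, ht]
    intro h
    have := MvPowerSeries.X_inj.1 h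
    exact absurd this (by decide)
  apply inj
  have m1 := ne _ d1
  have m2 := ne _ d2
  have m3 := ne _ d3
  have m4 := ne _ d4
  have m5 := ne _ d5
  have j1' := congrArg φ j1
  have j2' := congrArg φ j2
  have j3' := congrArg φ j3
  have j4' := congrArg φ j4
  have j5' := congrArg φ j5
  have hF' := congrArg φ hF
  simp only [map_mul, map_sub, map_add, map_one, map_zero, map_pow] at m1 m2 m3 m4 m5 j1' j2' j3' j4' j5' hF' ⊢
  exact field_fin _ _ _ _ _ _ _ _ m1 m2 m3 m4 m5 j1' j2' j3' j4' j5' hF'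

end TR


/-- The bigraded Poincaré series of the mixed trace algebra of two generic `3 × 3`
matrices is `1 / ((1−s)²(1−t)²(1−s²)(1−st)²(1−t²)(1−s²t)(1−st²))`. -/
theorem poincare_T32 (K : Type*) [Field K] [CharZero K] :
    mixedPS2 K 3 *
        ((1 - ps) ^ 2 * (1 - pt) ^ 2 * (1 - ps ^ 2) * (1 - ps * pt) ^ 2 * (1 - pt ^ 2) *
          (1 - ps ^ 2 * pt) * (1 - ps * pt ^ 2)) = 1 := by
  exact TR.main K ps pt rfl rfl
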